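/- arXiv:1603.00731 — 2 statements merged into one kernel-verified Lean document; each statement's English description precedes it below -/
import Mathlib

section
/- For every nonempty word ω over ℕ with last letter ω_k: the set {a(ω1), a(ω1,∞)} is the unique optimal set of two-means for the conditional probability measure P(·|J_ω) := P(· ∩ J_ω)/P(J_ω), and the set {a(ω^-(ω_k+1)), a(ω^-(ω_k+1),∞)} is the unique optimal set of two-means for the conditional probability measure P(·|J_{(ω,∞)}) := P(· ∩ J_{(ω,∞)})/P(J_{(ω,∞)}). Here ω1 denotes ω with the letter 1 appended. -/
open MeasureTheory

noncomputable section

/-- The contractive similarity `S j x = x / 2^(j+1) + 1 - 1/2^(j-1)` (used for `j ≥ 1`). -/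
def S (j : ℕ) (x : ℝ) : ℝ := x / 2 ^ (j + 1) + 1 - 1 / 2 ^ (j - 1)

/-- The similarity ratio `s j = 1/2^(j+1)`. -/
def s (j : ℕ) : ℝ := 1 / 2 ^ (j + 1)

/-- The probability vector: `p 1 = 1/4`, `p j = 3/2^(j+1)` for `j ≥ 2`. -/
def p (j : ℕ) : ℝ := if j = 1 then 1 / 4 else 3 / 2 ^ (j + 1)

/-- `Sw ω = S_{ω_1} ∘ ⋯ ∘ S_{ω_k}`. -/
def Sw (ω : List ℕ) : ℝ → ℝ := ω.foldr (fun j f => S j ∘ f) id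

/-- `pw ω = p_{ω_1} ⋯ p_{ω_k}`. -/
def pw (ω : List ℕ) : ℝ := (ω.map p).prod

/-- `sw ω = s_{ω_1} ⋯ s_{ω_k}`. -/
def sw (ω : List ℕ) : ℝ := (ω.map s).prod

/-- The basic interval `J_ω = S_ω([0,1])`. -/
def Jw (ω : List ℕ) : Set ℝ := Sw ω '' Set.Icc 0 1

/-- The last letter of a word (junk value `0` for the empty word). -/
def wlast (ω : List ℕ) : ℕ := ω.getLastD 0

/-- `wext ω j = ω^-(ω_k + j)`: the word `ω` with its last letter increased by `j`. -/
def wext (ω : List ℕ) (j : ℕ) : List ℕ := ω.dropLast ++ [wlast ω + j]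

/-- `J_{(ω,∞)} = ⋃_{j=1}^∞ J_{ω^-(ω_k+j)}`. -/
def Jinf (ω : List ℕ) : Set ℝ := ⋃ j : ℕ, Jw (wext ω (j + 1))

/-- `a(ω) = S_ω(4/7)`. -/
def aw (ω : List ℕ) : ℝ := Sw ω (4 / 7)

/-- `a(ω,∞) = S_{ω^-(ω_k+1)}(4/7) + (8/7) s_{ω^-(ω_k+1)}`. -/
def ainf (ω : List ℕ) : ℝ := Sw (wext ω 1) (4 / 7) + (8 / 7) * sw (wext ω 1)

/-- A (nonempty) word over the alphabet `{1, 2, 3, …}`. -/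
def IsWord (ω : List ℕ) : Prop := ω ≠ [] ∧ ∀ i ∈ ω, 1 ≤ i

/-- The invariance relation `P(A) = ∑_{j=1}^∞ p_j P(S_j⁻¹ A)`. -/
def Invariant (P : Measure ℝ) : Prop :=
  ∀ A : Set ℝ, MeasurableSet A →
    P A = ∑' j : ℕ, ENNReal.ofReal (p (j + 1)) * P (S (j + 1) ⁻¹' A)

/-- The distortion error `∫ min_{a ∈ α} (x-a)² dP` of a set `α ⊆ ℝ`. -/
def distortion (P : Measure ℝ) (α : Set ℝ) : ℝ :=
  ∫ x, (⨅ a : α, (x - (a : ℝ)) ^ 2) ∂P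

/-- The `n`-th quantization error for `P`. -/
def quantErr (P : Measure ℝ) (n : ℕ) : ℝ :=
  sInf {r : ℝ | ∃ α : Set ℝ, 1 ≤ α.ncard ∧ α.ncard ≤ n ∧ r = distortion P α}

/-- `α` is an optimal set of `n`-means for `P`. -/
def IsOptimal (P : Measure ℝ) (n : ℕ) (α : Set ℝ) : Prop :=
  1 ≤ α.ncard ∧ α.ncard ≤ n ∧ distortion P α = quantErr P n

/-- `E(a(ω)) = ∫_{J_ω} (x - a(ω))² dP`. -/
def Ea (P : Measure ℝ) (ω : List ℕ) : ℝ := ∫ x in Jw ω, (x - aw ω) ^ 2 ∂P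

/-- `E(a(ω,∞)) = ∫_{J_{(ω,∞)}} (x - a(ω,∞))² dP`. -/
def Eainf (P : Measure ℝ) (ω : List ℕ) : ℝ := ∫ x in Jinf ω, (x - ainf ω) ^ 2 ∂P

/-- The Voronoi region `M(a|α)`. -/
def voronoi (α : Set ℝ) (a : ℝ) : Set ℝ := {x : ℝ | ∀ b ∈ α, |x - a| ≤ |x - b|}

/-! ### Numeric lemmas -/

lemma num_core (c w H L u v : ℝ) (hc : 0 < c) (huv : u ≤ v)
    (hH : H ≤ L) (hL : L ^ 2 ≤ c * (w * (1 - w))) :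
    -c ≤ v ^ 2 + w * (u ^ 2 - v ^ 2) - 2 * (v - u) * H ∧
    (v ^ 2 + w * (u ^ 2 - v ^ 2) - 2 * (v - u) * H = -c →
      L ^ 2 = c * (w * (1 - w)) ∧ c = (v - u) * L ∧ w * u + (1 - w) * v = 0) := by
  have h1 : 0 ≤ (v - u) * (L - H) := mul_nonneg (by linarith) (by linarith)
  have h2 : 0 ≤ (v - u) ^ 2 * (c * (w * (1 - w)) - L ^ 2) :=
    mul_nonneg (sq_nonneg _) (by linarith)
  have h3 : 0 ≤ (c - (v - u) * L) ^ 2 := sq_nonneg _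
  have h4 : 0 ≤ c * (w * u + (1 - w) * v) ^ 2 := mul_nonneg hc.le (sq_nonneg _)
  have h5 : 0 ≤ c * ((v - u) * (L - H)) := mul_nonneg hc.le h1
  have key : c * (v ^ 2 + w * (u ^ 2 - v ^ 2) - 2 * (v - u) * H + c) =
      (c - (v - u) * L) ^ 2 + (v - u) ^ 2 * (c * (w * (1 - w)) - L ^ 2)
      + c * (w * u + (1 - w) * v) ^ 2 + 2 * (c * ((v - u) * (L - H))) := by ring
  constructor
  · have : 0 ≤ c * (v ^ 2 + w * (u ^ 2 - v ^ 2) - 2 * (v - u) * H + c) := by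
      rw [key]; positivity
    have := nonneg_of_mul_nonneg_right this hc
    linarith
  · intro he
    rw [he] at key
    have k3 : (c - (v - u) * L) ^ 2 = 0 := by nlinarith
    have k2 : (v - u) ^ 2 * (c * (w * (1 - w)) - L ^ 2) = 0 := by nlinarith
    have k4 : c * (w * u + (1 - w) * v) ^ 2 = 0 := by nlinarith
    have e3 : c - (v - u) * L = 0 := by simpa using k3
    have e4 : w * u + (1 - w) * v = 0 := by
      rcases mul_eq_zero.1 k4 with h | h
      · exact absurd h hc.ne'
      · simpa using h
    refine ⟨?_, by linarith, e4⟩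
    rcases mul_eq_zero.1 k2 with h | h
    · have : v - u = 0 := by simpa using h
      rw [this] at e3; linarith
    · linarith

lemma num_P (w H u v : ℝ) (huv : u ≤ v)
    (l0 : H ≤ 4 / 7 * w) (l1 : H ≤ 3 / 112 + 9 / 28 * w) (l2 : H ≤ 5 / 56 + 1 / 14 * w)
    (l3 : H ≤ 9 / 64 - 3 / 56 * w) (l4 : H ≤ 3 / 7 * (1 - w)) (w0 : 0 ≤ w) (w1 : w ≤ 1) :
    -(3 / 49) ≤ v ^ 2 + w * (u ^ 2 - v ^ 2) - 2 * (v - u) * H ∧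
    (v ^ 2 + w * (u ^ 2 - v ^ 2) - 2 * (v - u) * H = -(3 / 49) → u = -(3 / 7) ∧ v = 1 / 7) := by
  have main : ∀ L : ℝ, H ≤ L → L ^ 2 ≤ 3 / 49 * (w * (1 - w)) →
      (L ^ 2 = 3 / 49 * (w * (1 - w)) → (w = 1 / 4 ∧ L = 3 / 28) ∨ L = 0) →
      -(3 / 49) ≤ v ^ 2 + w * (u ^ 2 - v ^ 2) - 2 * (v - u) * H ∧
      (v ^ 2 + w * (u ^ 2 - v ^ 2) - 2 * (v - u) * H = -(3 / 49) → u = -(3 / 7) ∧ v = 1 / 7) := by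
    intro L h1 h2 h3
    obtain ⟨g1, g2⟩ := num_core (3 / 49) w H L u v (by norm_num) huv h1 h2
    refine ⟨g1, fun he => ?_⟩
    obtain ⟨e1, e2, e3⟩ := g2 he
    rcases h3 e1 with ⟨rfl, rfl⟩ | rfl
    · constructor <;> linarith
    · norm_num at e2
  rcases le_total w (1 / 10) with h | h
  · refine main _ l0 (by nlinarith) (fun he => Or.inr ?_)
    have : w * (19 / 49 * w - 3 / 49) = 0 := by linarith
    rcases mul_eq_zero.1 this with h' | h' <;> [(rw [h']; ring); linarith]
  rcases le_total w (1 / 4) with h' | h'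
  · have fac : (3 / 112 + 9 / 28 * w) ^ 2 - 3 / 49 * (w * (1 - w)) =
      (w - 1 / 4) * (w - 3 / 172) * (129 / 784) := by ring
    refine main _ l1 (by nlinarith) (fun he => Or.inl ?_)
    have : (w - 1 / 4) * (w - 3 / 172) = 0 := by linarith
    rcases mul_eq_zero.1 this with k | k
    · have : w = 1 / 4 := by linarith
      subst this; norm_num
    · linarith
  rcases le_total w (12 / 25) with h2 | h2
  · have fac : (5 / 56 + 1 / 14 * w) ^ 2 - 3 / 49 * (w * (1 - w)) =
      (w - 1 / 4) * (w - 25 / 52) * (13 / 196) := by ring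
    refine main _ l2 (by nlinarith) (fun he => Or.inl ?_)
    have : (w - 1 / 4) * (w - 25 / 52) = 0 := by linarith
    rcases mul_eq_zero.1 this with k | k
    · have : w = 1 / 4 := by linarith
      subst this; norm_num
    · linarith
  rcases le_total w (77 / 100) with h3 | h3
  · have : (9 / 64 - 3 / 56 * w) ^ 2 < 3 / 49 * (w * (1 - w)) := by nlinarith
    exact main _ l3 this.le (fun he => absurd he this.ne)
  · refine main _ l4 (by nlinarith) (fun he => Or.inr ?_)
    have : (1 - w) * (9 / 49 - 12 / 49 * w) = 0 := by linarith
    rcases mul_eq_zero.1 this with h' | h' <;> [(rw [h']; ring); linarith]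

lemma num_Q (w H u v : ℝ) (huv : u ≤ v)
    (l0 : H ≤ 3 / 14 * w) (l1 : H ≤ 3 / 112 + 5 / 56 * w) (l2 : H ≤ 5 / 56 - 1 / 28 * w)
    (l3 : H ≤ 57 / 448 - 11 / 112 * w) (l4 : H ≤ 2 / 7 * (1 - w)) (w0 : 0 ≤ w) (w1 : w ≤ 1) :
    -(1 / 49) ≤ v ^ 2 + w * (u ^ 2 - v ^ 2) - 2 * (v - u) * H ∧
    (v ^ 2 + w * (u ^ 2 - v ^ 2) - 2 * (v - u) * H = -(1 / 49) → u = -(1 / 7) ∧ v = 1 / 7) := by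
  have main : ∀ L : ℝ, H ≤ L → L ^ 2 ≤ 1 / 49 * (w * (1 - w)) →
      (L ^ 2 = 1 / 49 * (w * (1 - w)) → (w = 1 / 2 ∧ L = 1 / 14) ∨ L = 0) →
      -(1 / 49) ≤ v ^ 2 + w * (u ^ 2 - v ^ 2) - 2 * (v - u) * H ∧
      (v ^ 2 + w * (u ^ 2 - v ^ 2) - 2 * (v - u) * H = -(1 / 49) → u = -(1 / 7) ∧ v = 1 / 7) := by
    intro L h1 h2 h3
    obtain ⟨g1, g2⟩ := num_core (1 / 49) w H L u v (by norm_num) huv h1 h2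
    refine ⟨g1, fun he => ?_⟩
    obtain ⟨e1, e2, e3⟩ := g2 he
    rcases h3 e1 with ⟨rfl, rfl⟩ | rfl
    · constructor <;> linarith
    · norm_num at e2
  rcases le_total w (1 / 5) with h | h
  · refine main _ l0 (by nlinarith) (fun he => Or.inr ?_)
    have : w * (13 / 196 * w - 4 / 196) = 0 := by linarith
    rcases mul_eq_zero.1 this with h' | h' <;> [(rw [h']; ring); linarith]
  rcases le_total w (1 / 2) with h' | h'
  · have fac : (3 / 112 + 5 / 56 * w) ^ 2 - 1 / 49 * (w * (1 - w)) =
      (w - 1 / 2) * (w - 9 / 178) * (89 / 3136) := by ring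
    refine main _ l1 (by nlinarith) (fun he => Or.inl ?_)
    have : (w - 1 / 2) * (w - 9 / 178) = 0 := by linarith
    rcases mul_eq_zero.1 this with k | k
    · have : w = 1 / 2 := by linarith
      subst this; norm_num
    · linarith
  rcases le_total w (73 / 100) with h2 | h2
  · have fac : (5 / 56 - 1 / 28 * w) ^ 2 - 1 / 49 * (w * (1 - w)) =
      (w - 1 / 2) * (w - 25 / 34) * (17 / 784) := by ring
    refine main _ l2 (by nlinarith) (fun he => Or.inl ?_)
    have : (w - 1 / 2) * (w - 25 / 34) = 0 := by linarith
    rcases mul_eq_zero.1 this with k | k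
    · have : w = 1 / 2 := by linarith
      subst this; norm_num
    · linarith
  rcases le_total w (82 / 100) with h3 | h3
  · have : (57 / 448 - 11 / 112 * w) ^ 2 < 1 / 49 * (w * (1 - w)) := by nlinarith
    exact main _ l3 this.le (fun he => absurd he this.ne)
  · refine main _ l4 (by nlinarith) (fun he => Or.inr ?_)
    have : (1 - w) * (4 / 49 - 5 / 49 * w) = 0 := by linarith
    rcases mul_eq_zero.1 this with h' | h' <;> [(rw [h']; ring); linarith]

/-! ### Integral formulas -/

/-- The two-point distortion. -/
def DD (μ : Measure ℝ) (a b : ℝ) : ℝ := ∫ x, min ((x - a) ^ 2) ((x - b) ^ 2) ∂μ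

lemma integrable_of_cont {μ : Measure ℝ} [IsFiniteMeasure μ]
    (hs : ∀ᵐ x ∂μ, x ∈ Set.Icc (0 : ℝ) 1) {f : ℝ → ℝ} (hf : Continuous f) : Integrable f μ := by
  have h : μ.restrict (Set.Icc 0 1) = μ := Measure.restrict_eq_self_of_ae_mem hs
  rw [← h]
  exact hf.continuousOn.integrableOn_compact isCompact_Icc

lemma core {μ : Measure ℝ} [IsProbabilityMeasure μ]
    (hs : ∀ᵐ x ∂μ, x ∈ Set.Icc (0 : ℝ) 1) (m : ℝ) (hm : ∫ x, x ∂μ = m)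
    (a b : ℝ) (hab : a ≤ b) :
    ∃ w H : ℝ, 0 ≤ w ∧ w ≤ 1 ∧
      DD μ a b = ∫ x, (x - m) ^ 2 ∂μ +
        ((b - m) ^ 2 + w * ((a - m) ^ 2 - (b - m) ^ 2) - 2 * ((b - m) - (a - m)) * H) ∧
      ∀ y : ℝ, H ≤ ∫ x, max (y - x) 0 ∂μ + (m - y) * w := by
  set A : Set ℝ := Set.Iic ((a + b) / 2) with hA
  have hAm : MeasurableSet A := measurableSet_Iic
  have hint : ∀ {f : ℝ → ℝ}, Continuous f → Integrable f μ := fun hf => integrable_of_cont hs hf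
  refine ⟨μ.real A, ∫ x in A, (m - x) ∂μ, measureReal_nonneg, measureReal_le_one, ?_, ?_⟩
  · have h1 : ∀ x, min ((x - a) ^ 2) ((x - b) ^ 2) =
        ((x - m) ^ 2 + ((b - m) ^ 2 + 2 * (b - m) * m) - 2 * (b - m) * x) + A.indicator
          (fun x => ((a - m) ^ 2 - (b - m) ^ 2) - 2 * ((b - m) - (a - m)) * (m - x)) x := by
      intro x
      by_cases hx : x ∈ A
      · rw [Set.indicator_of_mem hx, min_eq_left]
        · ring
        · have : x ≤ (a + b) / 2 := hx
          nlinarith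
      · rw [Set.indicator_of_notMem hx, min_eq_right]
        · ring
        · have : (a + b) / 2 < x := not_le.1 hx
          nlinarith
    unfold DD
    simp_rw [h1]
    rw [integral_add (hint (by fun_prop)) ((hint (by fun_prop)).indicator hAm),
      integral_indicator hAm, integral_sub (hint (by fun_prop)) (hint (by fun_prop)),
      integral_add (hint (by fun_prop)) (hint (by fun_prop)),
      integral_sub (hint (by fun_prop)).integrableOn (hint (by fun_prop)).integrableOn,
      integral_const_mul, integral_const_mul, hm]
    simp
    ring
  · intro y
    have e : ∫ x in A, (m - x) ∂μ = ∫ x in A, (y - x) ∂μ + (m - y) * μ.real A := by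
      have : (fun x : ℝ => m - x) = fun x => (y - x) + (m - y) := by ext; ring
      rw [this, integral_add (hint (by fun_prop)).integrableOn (hint (by fun_prop)).integrableOn]
      simp; ring
    rw [e]
    gcongr
    calc ∫ x in A, (y - x) ∂μ ≤ ∫ x in A, max (y - x) 0 ∂μ :=
          integral_mono (hint (by fun_prop)).integrableOn (hint (by fun_prop)).integrableOn
            (fun x => le_max_left _ _)
      _ ≤ _ := setIntegral_le_integral (hint (by fun_prop))
            (Filter.Eventually.of_forall fun x => le_max_right _ _)

/-- `T y = (1 + y) / 2`. -/
def TT (y : ℝ) : ℝ := (1 + y) / 2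

/-- The structural data: `P = ¼ S₁P + ¾ Q`, `Q = ½ S₂P + ½ TQ`. -/
structure Sys (P Q : Measure ℝ) : Prop where
  sP : ∀ᵐ x ∂P, x ∈ Set.Icc (0 : ℝ) 1
  sQ : ∀ᵐ x ∂Q, x ∈ Set.Icc (1 / 2 : ℝ) 1
  iP : P = ENNReal.ofReal (1 / 4) • P.map (S 1) + ENNReal.ofReal (3 / 4) • Q
  iQ : Q = ENNReal.ofReal (1 / 2) • P.map (S 2) + ENNReal.ofReal (1 / 2) • Q.map TT

lemma S_cont (j : ℕ) : Continuous (S j) := by unfold S; fun_prop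
lemma TT_cont : Continuous TT := by unfold TT; fun_prop
lemma S1_eq (x : ℝ) : S 1 x = x / 4 := by unfold S; norm_num
lemma S2_eq (x : ℝ) : S 2 x = x / 8 + 1 / 2 := by unfold S; norm_num; ring

section sys
variable {P Q : Measure ℝ} [IsProbabilityMeasure P] [IsProbabilityMeasure Q]

lemma Sys.sQ' (h : Sys P Q) : ∀ᵐ x ∂Q, x ∈ Set.Icc (0 : ℝ) 1 := by
  filter_upwards [h.sQ] with x hx
  exact ⟨by linarith [hx.1], hx.2⟩

lemma Sys.intP (h : Sys P Q) {f : ℝ → ℝ} (hf : Continuous f) :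
    ∫ x, f x ∂P = 1 / 4 * ∫ x, f (x / 4) ∂P + 3 / 4 * ∫ x, f x ∂Q := by
  have i1 : Integrable f (P.map (S 1)) := by
    rw [integrable_map_measure hf.aestronglyMeasurable (S_cont 1).aemeasurable]
    exact integrable_of_cont h.sP (hf.comp (S_cont 1))
  have i2 : Integrable f Q := integrable_of_cont h.sQ' hf
  conv_lhs => rw [h.iP]
  rw [integral_add_measure (i1.smul_measure (by simp)) (i2.smul_measure (by simp)),
    integral_smul_measure, integral_smul_measure,
    integral_map (S_cont 1).aemeasurable hf.aestronglyMeasurable]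
  simp only [S1_eq]
  rw [ENNReal.toReal_ofReal (by norm_num), ENNReal.toReal_ofReal (by norm_num)]
  simp only [smul_eq_mul]

lemma Sys.intQ (h : Sys P Q) {f : ℝ → ℝ} (hf : Continuous f) :
    ∫ x, f x ∂Q = 1 / 2 * ∫ x, f (x / 8 + 1 / 2) ∂P + 1 / 2 * ∫ x, f ((1 + x) / 2) ∂Q := by
  have i1 : Integrable f (P.map (S 2)) := by
    rw [integrable_map_measure hf.aestronglyMeasurable (S_cont 2).aemeasurable]
    exact integrable_of_cont h.sP (hf.comp (S_cont 2))
  have i2 : Integrable f (Q.map TT) := by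
    rw [integrable_map_measure hf.aestronglyMeasurable TT_cont.aemeasurable]
    exact integrable_of_cont h.sQ' (hf.comp TT_cont)
  conv_lhs => rw [h.iQ]
  rw [integral_add_measure (i1.smul_measure (by simp)) (i2.smul_measure (by simp)),
    integral_smul_measure, integral_smul_measure,
    integral_map (S_cont 2).aemeasurable hf.aestronglyMeasurable,
    integral_map TT_cont.aemeasurable hf.aestronglyMeasurable]
  simp only [S2_eq, TT]
  rw [ENNReal.toReal_ofReal (by norm_num)]
  simp only [smul_eq_mul]

lemma int_aff {μ : Measure ℝ} [IsProbabilityMeasure μ]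
    (hs : ∀ᵐ x ∂μ, x ∈ Set.Icc (0 : ℝ) 1) (c d : ℝ) :
    ∫ x, (c * x + d) ∂μ = c * ∫ x, x ∂μ + d := by
  rw [integral_add (integrable_of_cont hs (by fun_prop)) (integrable_of_cont hs (by fun_prop)),
    integral_const_mul]
  simp

/-- If `f` agrees with an affine map on the support, integrate it. -/
lemma int_eq_aff {μ : Measure ℝ} [IsProbabilityMeasure μ] {u : ℝ} (hu : 0 ≤ u)
    (hs : ∀ᵐ x ∂μ, x ∈ Set.Icc u 1) {f : ℝ → ℝ} (c d : ℝ)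
    (hf : ∀ x ∈ Set.Icc u 1, f x = c * x + d) :
    ∫ x, f x ∂μ = c * ∫ x, x ∂μ + d := by
  have hs' : ∀ᵐ x ∂μ, x ∈ Set.Icc (0 : ℝ) 1 := by
    filter_upwards [hs] with x hx
    exact ⟨by linarith [hx.1], hx.2⟩
  rw [← int_aff hs']
  refine integral_congr_ae ?_
  filter_upwards [hs] with x hx
  exact hf x hx

lemma Sys.means (h : Sys P Q) : ∫ x, x ∂P = 4 / 7 ∧ ∫ x, x ∂Q = 5 / 7 := by
  have h1 := h.intP continuous_id
  have h2 := h.intQ continuous_id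
  simp only [id] at h1 h2
  rw [int_eq_aff (f := fun x => x / 4) le_rfl h.sP (1 / 4) 0 (by intros; ring)] at h1
  rw [int_eq_aff (f := fun x => x / 8 + 1 / 2) le_rfl h.sP (1 / 8) (1 / 2) (by intros; ring),
    int_eq_aff (f := fun x => (1 + x) / 2) (by norm_num) h.sQ (1 / 2) (1 / 2)
      (by intros; ring)] at h2
  constructor <;> linarith

lemma Sys.lowP (h : Sys P Q) (a b : ℝ) (hab : a ≤ b) :
    ∫ x, (x - 4 / 7) ^ 2 ∂P - 3 / 49 ≤ DD P a b ∧
    (DD P a b = ∫ x, (x - 4 / 7) ^ 2 ∂P - 3 / 49 → a = 1 / 7 ∧ b = 5 / 7) := by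
  obtain ⟨mP, mQ⟩ := h.means
  obtain ⟨w, H, w0, w1, hD, hy⟩ := core h.sP _ mP a b hab
  have q0 : ∫ x, max (0 - x) 0 ∂P = 0 := by
    rw [int_eq_aff le_rfl h.sP 0 0
      (fun x hx => by rw [max_eq_right (by linarith [hx.1])]; ring)]; ring
  have q1 : ∫ x, max (1 - x) 0 ∂P = 3 / 7 := by
    rw [int_eq_aff le_rfl h.sP (-1) 1
      (fun x hx => by rw [max_eq_left (by linarith [hx.2])]; ring), mP]; norm_num
  have q2 : ∫ x, max (1 / 4 - x) 0 ∂P = 3 / 112 := by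
    rw [h.intP (by fun_prop), int_eq_aff le_rfl h.sP (-1 / 4) (1 / 4)
      (fun x hx => by rw [max_eq_left (by linarith [hx.2])]; ring),
      int_eq_aff (by norm_num) h.sQ 0 0
      (fun x hx => by rw [max_eq_right (by linarith [hx.1])]; ring), mP]; norm_num
  have q3 : ∫ x, max (1 / 2 - x) 0 ∂P = 5 / 56 := by
    rw [h.intP (by fun_prop), int_eq_aff le_rfl h.sP (-1 / 4) (1 / 2)
      (fun x hx => by rw [max_eq_left (by linarith [hx.2])]; ring),
      int_eq_aff (by norm_num) h.sQ 0 0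
      (fun x hx => by rw [max_eq_right (by linarith [hx.1])]; ring), mP]; norm_num
  have q4 : ∫ x, max (5 / 8 - x) 0 ∂P = 9 / 64 := by
    rw [h.intP (by fun_prop), int_eq_aff le_rfl h.sP (-1 / 4) (5 / 8)
      (fun x hx => by rw [max_eq_left (by linarith [hx.2])]; ring),
      mP, h.intQ (by fun_prop), int_eq_aff le_rfl h.sP (-1 / 8) (1 / 8)
      (fun x hx => by rw [max_eq_left (by linarith [hx.2])]; ring),
      int_eq_aff (by norm_num) h.sQ 0 0
      (fun x hx => by rw [max_eq_right (by linarith [hx.1])]; ring), mP]; norm_num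
  have y0 := hy 0
  have y1 := hy 1
  have y2 := hy (1 / 4)
  have y3 := hy (1 / 2)
  have y4 := hy (5 / 8)
  rw [q0] at y0; rw [q1] at y1; rw [q2] at y2; rw [q3] at y3; rw [q4] at y4
  obtain ⟨g1, g2⟩ := num_P w H (a - 4 / 7) (b - 4 / 7) (by linarith) (by linarith) (by linarith)
    (by linarith) (by linarith) (by linarith) w0 w1
  refine ⟨by rw [hD]; linarith, fun he => ?_⟩
  obtain ⟨e1, e2⟩ := g2 (by rw [hD] at he; linarith)
  constructor <;> linarith

lemma Sys.lowQ (h : Sys P Q) (a b : ℝ) (hab : a ≤ b) :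
    ∫ x, (x - 5 / 7) ^ 2 ∂Q - 1 / 49 ≤ DD Q a b ∧
    (DD Q a b = ∫ x, (x - 5 / 7) ^ 2 ∂Q - 1 / 49 → a = 4 / 7 ∧ b = 6 / 7) := by
  obtain ⟨mP, mQ⟩ := h.means
  have h2 : (0 : ℝ) ≤ 1 / 2 := by norm_num
  obtain ⟨w, H, w0, w1, hD, hy⟩ := core h.sQ' _ mQ a b hab
  have q0 : ∫ x, max (1 / 2 - x) 0 ∂Q = 0 := by
    rw [int_eq_aff h2 h.sQ 0 0
      (fun x hx => by rw [max_eq_right (by linarith [hx.1])]; ring)]; ring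
  have q1 : ∫ x, max (1 - x) 0 ∂Q = 2 / 7 := by
    rw [int_eq_aff h2 h.sQ (-1) 1
      (fun x hx => by rw [max_eq_left (by linarith [hx.2])]; ring), mQ]; norm_num
  have q2 : ∫ x, max (5 / 8 - x) 0 ∂Q = 3 / 112 := by
    rw [h.intQ (by fun_prop), int_eq_aff le_rfl h.sP (-1 / 8) (1 / 8)
      (fun x hx => by rw [max_eq_left (by linarith [hx.2])]; ring),
      int_eq_aff h2 h.sQ 0 0
      (fun x hx => by rw [max_eq_right (by linarith [hx.1])]; ring), mP]; norm_num
  have q3 : ∫ x, max (3 / 4 - x) 0 ∂Q = 5 / 56 := by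
    rw [h.intQ (by fun_prop), int_eq_aff le_rfl h.sP (-1 / 8) (1 / 4)
      (fun x hx => by rw [max_eq_left (by linarith [hx.2])]; ring),
      int_eq_aff h2 h.sQ 0 0
      (fun x hx => by rw [max_eq_right (by linarith [hx.1])]; ring), mP]; norm_num
  have q4 : ∫ x, max (13 / 16 - x) 0 ∂Q = 57 / 448 := by
    rw [h.intQ (by fun_prop), int_eq_aff le_rfl h.sP (-1 / 8) (5 / 16)
      (fun x hx => by rw [max_eq_left (by linarith [hx.2])]; ring),
      mP, h.intQ (by fun_prop), int_eq_aff le_rfl h.sP (-1 / 16) (1 / 16)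
      (fun x hx => by rw [max_eq_left (by linarith [hx.2])]; ring),
      int_eq_aff h2 h.sQ 0 0
      (fun x hx => by rw [max_eq_right (by linarith [hx.1])]; ring), mP]; norm_num
  have y0 := hy (1 / 2)
  have y1 := hy 1
  have y2 := hy (5 / 8)
  have y3 := hy (3 / 4)
  have y4 := hy (13 / 16)
  rw [q0] at y0; rw [q1] at y1; rw [q2] at y2; rw [q3] at y3; rw [q4] at y4
  obtain ⟨g1, g2⟩ := num_Q w H (a - 5 / 7) (b - 5 / 7) (by linarith) (by linarith) (by linarith)
    (by linarith) (by linarith) (by linarith) w0 w1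
  refine ⟨by rw [hD]; linarith, fun he => ?_⟩
  obtain ⟨e1, e2⟩ := g2 (by rw [hD] at he; linarith)
  constructor <;> linarith

/-- Upper bound helper: `∫ g ≤ ∫ f + c * mean + d` when `g ≤ f + (c x + d)`. -/
lemma int_le_aff {μ : Measure ℝ} [IsProbabilityMeasure μ]
    (hs : ∀ᵐ x ∂μ, x ∈ Set.Icc (0 : ℝ) 1) {f g : ℝ → ℝ} (hf : Continuous f) (hg : Continuous g)
    (c d : ℝ) (hfg : ∀ x, g x ≤ f x + (c * x + d)) :
    ∫ x, g x ∂μ ≤ ∫ x, f x ∂μ + (c * ∫ x, x ∂μ + d) := by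
  rw [← int_aff hs, ← integral_add (integrable_of_cont hs hf) (integrable_of_cont hs (by fun_prop))]
  exact integral_mono (integrable_of_cont hs hg) (integrable_of_cont hs (by fun_prop)) hfg

lemma Sys.upP (h : Sys P Q) : DD P (1 / 7) (5 / 7) ≤ ∫ x, (x - 4 / 7) ^ 2 ∂P - 3 / 49 := by
  obtain ⟨mP, mQ⟩ := h.means
  unfold DD
  rw [h.intP (by fun_prop), h.intP (f := fun x => (x - 4 / 7) ^ 2) (by fun_prop)]
  have h1 := int_le_aff h.sP (f := fun x => (x / 4 - 4 / 7) ^ 2)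
    (g := fun x => min ((x / 4 - 1 / 7) ^ 2) ((x / 4 - 5 / 7) ^ 2)) (by fun_prop) (by fun_prop)
    (3 / 14) (-15 / 49) (fun x => (min_le_left _ _).trans (le_of_eq (by ring)))
  have h2 := int_le_aff h.sQ' (f := fun x => (x - 4 / 7) ^ 2)
    (g := fun x => min ((x - 1 / 7) ^ 2) ((x - 5 / 7) ^ 2)) (by fun_prop) (by fun_prop)
    (-2 / 7) (9 / 49) (fun x => (min_le_right _ _).trans (le_of_eq (by ring)))
  rw [mP] at h1
  rw [mQ] at h2
  linarith

lemma Sys.upQ (h : Sys P Q) : DD Q (4 / 7) (6 / 7) ≤ ∫ x, (x - 5 / 7) ^ 2 ∂Q - 1 / 49 := by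
  obtain ⟨mP, mQ⟩ := h.means
  unfold DD
  rw [h.intQ (by fun_prop), h.intQ (f := fun x => (x - 5 / 7) ^ 2) (by fun_prop)]
  have h1 := int_le_aff h.sP (f := fun x => (x / 8 + 1 / 2 - 5 / 7) ^ 2)
    (g := fun x => min ((x / 8 + 1 / 2 - 4 / 7) ^ 2) ((x / 8 + 1 / 2 - 6 / 7) ^ 2))
    (by fun_prop) (by fun_prop)
    (1 / 28) (-2 / 49) (fun x => (min_le_left _ _).trans (le_of_eq (by ring)))
  have h2 := int_le_aff h.sQ' (f := fun x => ((1 + x) / 2 - 5 / 7) ^ 2)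
    (g := fun x => min (((1 + x) / 2 - 4 / 7) ^ 2) (((1 + x) / 2 - 6 / 7) ^ 2))
    (by fun_prop) (by fun_prop)
    (-1 / 7) (4 / 49) (fun x => (min_le_right _ _).trans (le_of_eq (by ring)))
  rw [mP] at h1
  rw [mQ] at h2
  linarith

end sys

/-- `(a₀, b₀)` uniquely minimises the two-point distortion. -/
def UOpt (μ : Measure ℝ) (a₀ b₀ : ℝ) : Prop :=
  a₀ ≤ b₀ ∧ ∀ a b, a ≤ b → DD μ a₀ b₀ ≤ DD μ a b ∧ (DD μ a b = DD μ a₀ b₀ → a = a₀ ∧ b = b₀)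

lemma Sys.uoptP {P Q : Measure ℝ} [IsProbabilityMeasure P] [IsProbabilityMeasure Q]
    (h : Sys P Q) : UOpt P (1 / 7) (5 / 7) :=
  ⟨by norm_num, fun a b hab => ⟨h.upP.trans (h.lowP a b hab).1, fun he =>
    (h.lowP a b hab).2 (le_antisymm (he ▸ h.upP) (h.lowP a b hab).1)⟩⟩

lemma Sys.uoptQ {P Q : Measure ℝ} [IsProbabilityMeasure P] [IsProbabilityMeasure Q]
    (h : Sys P Q) : UOpt Q (4 / 7) (6 / 7) :=
  ⟨by norm_num, fun a b hab => ⟨h.upQ.trans (h.lowQ a b hab).1, fun he =>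
    (h.lowQ a b hab).2 (le_antisymm (he ▸ h.upQ) (h.lowQ a b hab).1)⟩⟩

lemma DD_map (μ : Measure ℝ) (r c : ℝ) (a b : ℝ) :
    DD (μ.map (fun x => r * x + c)) (r * a + c) (r * b + c) = r ^ 2 * DD μ a b := by
  unfold DD
  rw [integral_map (by fun_prop) (by fun_prop), ← integral_const_mul]
  congr 1
  ext x
  rw [mul_min_of_nonneg _ _ (sq_nonneg r)]
  congr 1 <;> ring

lemma UOpt.map {μ : Measure ℝ} {a b : ℝ} (h : UOpt μ a b) (r c : ℝ) (hr : 0 < r) :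
    UOpt (μ.map (fun x => r * x + c)) (r * a + c) (r * b + c) := by
  refine ⟨by nlinarith [h.1], fun a' b' hab => ?_⟩
  have ea : a' = r * ((a' - c) / r) + c := by field_simp; ring
  have eb : b' = r * ((b' - c) / r) + c := by field_simp; ring
  generalize (a' - c) / r = x at ea
  generalize (b' - c) / r = y at eb
  subst ea eb
  have hxy : x ≤ y := by
    by_contra hc
    nlinarith [not_le.1 hc]
  obtain ⟨h1, h2⟩ := h.2 x y hxy
  have hr2 : 0 < r ^ 2 := by positivity
  rw [DD_map, DD_map]
  refine ⟨by nlinarith, fun he => ?_⟩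
  obtain ⟨rfl, rfl⟩ := h2 (mul_left_cancel₀ hr2.ne' he)
  exact ⟨rfl, rfl⟩

lemma distortion_pair (μ : Measure ℝ) (a b : ℝ) :
    distortion μ ({a, b} : Set ℝ) = DD μ a b := by
  unfold distortion DD
  congr 1
  ext x
  have h : (⨅ c : ({a, b} : Set ℝ), (x - (c : ℝ)) ^ 2) =
      sInf ((fun c : ℝ => (x - c) ^ 2) '' {a, b}) := by
    rw [sInf_image']
  rw [h, Set.image_pair, csInf_pair]

lemma exists_pair {α : Set ℝ} (h1 : 1 ≤ α.ncard) (h2 : α.ncard ≤ 2) :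
    ∃ a b, a ≤ b ∧ α = {a, b} := by
  have : α.ncard = 1 ∨ α.ncard = 2 := by omega
  rcases this with h | h
  · obtain ⟨a, rfl⟩ := Set.ncard_eq_one.1 h
    exact ⟨a, a, le_rfl, by simp⟩
  · obtain ⟨a, b, _, rfl⟩ := Set.ncard_eq_two.1 h
    rcases le_total a b with h | h
    · exact ⟨a, b, h, rfl⟩
    · exact ⟨b, a, h, Set.pair_comm _ _⟩

lemma UOpt.isOptimal {μ : Measure ℝ} {a b : ℝ} (h : UOpt μ a b) :
    IsOptimal μ 2 ({a, b} : Set ℝ) ∧ ∀ α, IsOptimal μ 2 α → α = ({a, b} : Set ℝ) := by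
  have c1 : 1 ≤ ({a, b} : Set ℝ).ncard :=
    (Set.ncard_pos (Set.toFinite _)).2 ⟨a, by simp⟩
  have c2 : ({a, b} : Set ℝ).ncard ≤ 2 := (Set.ncard_insert_le _ _).trans (by simp)
  have hq : quantErr μ 2 = DD μ a b := by
    unfold quantErr
    refine IsLeast.csInf_eq ⟨⟨_, c1, c2, (distortion_pair μ a b).symm⟩, ?_⟩
    rintro r ⟨α, h1, h2, rfl⟩
    obtain ⟨x, y, hxy, rfl⟩ := exists_pair h1 h2
    rw [distortion_pair]
    exact (h.2 x y hxy).1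
  refine ⟨⟨c1, c2, by rw [distortion_pair, hq]⟩, ?_⟩
  rintro α ⟨h1, h2, h3⟩
  obtain ⟨x, y, hxy, rfl⟩ := exists_pair h1 h2
  rw [distortion_pair, hq] at h3
  obtain ⟨rfl, rfl⟩ := (h.2 x y hxy).2 h3
  rfl

/-! ### Self-similarity -/

lemma S_succ (j : ℕ) (x : ℝ) : S (j + 1) x = x / 2 ^ (j + 2) + 1 - 1 / 2 ^ j := by
  simp [S]

lemma S_lt {i j : ℕ} (hij : i < j) {x y : ℝ} (hx : x ∈ Set.Icc (0 : ℝ) 1)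
    (hy : y ∈ Set.Icc (0 : ℝ) 1) : S (i + 1) x < S (j + 1) y := by
  rw [S_succ, S_succ]
  have hpos : (0 : ℝ) < 1 / 2 ^ i := by positivity
  have h1 : x / 2 ^ (i + 2) ≤ 1 / 2 ^ i / 4 := by
    rw [pow_add, div_div]
    gcongr
    · exact hx.2
    · norm_num
  have h2 : (0 : ℝ) ≤ y / 2 ^ (j + 2) := div_nonneg hy.1 (by positivity)
  have h3 : (1 : ℝ) / 2 ^ j ≤ 1 / 2 ^ i / 2 := by
    rw [div_div, ← pow_succ]
    gcongr
    · norm_num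
    · exact hij
  linarith

lemma S_mem (j : ℕ) {x : ℝ} (hx : x ∈ Set.Icc (0 : ℝ) 1) : S (j + 1) x ∈ Set.Icc (0 : ℝ) 1 := by
  rw [S_succ]
  have hpos : (0 : ℝ) < 1 / 2 ^ j := by positivity
  have h1 : x / 2 ^ (j + 2) ≤ 1 / 2 ^ j / 4 := by
    rw [pow_add, div_div]
    gcongr
    · exact hx.2
    · norm_num
  have h2 : (0 : ℝ) ≤ x / 2 ^ (j + 2) := div_nonneg hx.1 (by positivity)
  have h3 : (1 : ℝ) / 2 ^ j ≤ 1 := by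
    rw [div_le_one (by positivity)]
    exact one_le_pow₀ (by norm_num)
  constructor <;> linarith

lemma S_mem2 (j : ℕ) {x : ℝ} (hx : x ∈ Set.Icc (0 : ℝ) 1) :
    S (j + 2) x ∈ Set.Icc (1 / 2 : ℝ) 1 := by
  refine ⟨?_, (S_mem (j + 1) hx).2⟩
  rw [S_succ]
  have h2 : (0 : ℝ) ≤ x / 2 ^ (j + 1 + 2) := div_nonneg hx.1 (by positivity)
  have h3 : (1 : ℝ) / 2 ^ (j + 1) ≤ 1 / 2 := by
    rw [pow_succ, ← div_div]
    have : (1 : ℝ) / 2 ^ j ≤ 1 := by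
      rw [div_le_one (by positivity)]
      exact one_le_pow₀ (by norm_num)
    linarith
  linarith

lemma S_inj (j : ℕ) : Function.Injective (S j) := by
  intro x y h
  simp only [S] at h
  have : x / 2 ^ (j + 1) = y / 2 ^ (j + 1) := by linarith
  rwa [div_left_inj' (by positivity)] at this

lemma S_emb (j : ℕ) : MeasurableEmbedding (S j) := (S_cont j).measurableEmbedding (S_inj j)

/-- The affine map `y ↦ 1 - (1 - y) / 2^k`. -/
def Tk (k : ℕ) (y : ℝ) : ℝ := (1 / 2 ^ k) * y + (1 - 1 / 2 ^ k)

lemma S_Tk (k j : ℕ) (x : ℝ) : S (k + j + 2) x = Tk k (S (j + 2) x) := by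
  rw [S_succ, S_succ, Tk]
  have : (2 : ℝ) ^ k ≠ 0 := by positivity
  have : (2 : ℝ) ^ j ≠ 0 := by positivity
  simp only [pow_add]
  field_simp
  ring

lemma p_add (k j : ℕ) : p (k + j + 2) = 3 / 2 ^ (k + 2) * (1 / 2 ^ (j + 1)) := by
  unfold p
  rw [if_neg (by omega)]
  simp only [pow_add]
  field_simp

lemma p_pos (j : ℕ) : 0 < p j := by
  unfold p
  split_ifs <;> positivity

lemma Sw_cons (j : ℕ) (ω : List ℕ) : Sw (j :: ω) = S j ∘ Sw ω := rfl

lemma Sw_append (ω τ : List ℕ) : Sw (ω ++ τ) = Sw ω ∘ Sw τ := by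
  induction ω with
  | nil => rfl
  | cons j ω ih => rw [List.cons_append, Sw_cons, ih, Sw_cons, Function.comp_assoc]

lemma Sw_single (j : ℕ) : Sw [j] = S j := rfl

lemma sw_append (ω τ : List ℕ) : sw (ω ++ τ) = sw ω * sw τ := by simp [sw]

lemma sw_pos (ω : List ℕ) : 0 < sw ω := by
  induction ω with
  | nil => simp [sw]
  | cons j ω ih =>
    have : sw (j :: ω) = s j * sw ω := by simp [sw]
    rw [this]
    exact mul_pos (by unfold s; positivity) ih

lemma pw_pos (ω : List ℕ) : 0 < pw ω := by
  induction ω with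
  | nil => simp [pw]
  | cons j ω ih =>
    have : pw (j :: ω) = p j * pw ω := by simp [pw]
    rw [this]
    exact mul_pos (p_pos j) ih

lemma Sw_affine (ω : List ℕ) (x : ℝ) : Sw ω x = sw ω * x + Sw ω 0 := by
  induction ω with
  | nil => simp [Sw, sw]
  | cons j ω ih =>
    have h : sw (j :: ω) = s j * sw ω := by simp [sw]
    rw [Sw_cons, Function.comp_apply, Function.comp_apply, ih, h]
    simp only [S, s]
    ring

lemma Sw_cont (ω : List ℕ) : Continuous (Sw ω) := by
  have : Sw ω = fun x => sw ω * x + Sw ω 0 := funext (Sw_affine ω)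
  rw [this]; fun_prop

lemma Sw_inj (ω : List ℕ) : Function.Injective (Sw ω) := by
  intro x y h
  rw [Sw_affine, Sw_affine ω y] at h
  have : sw ω * x = sw ω * y := by linarith
  exact mul_left_cancel₀ (sw_pos ω).ne' this

lemma Sw_emb (ω : List ℕ) : MeasurableEmbedding (Sw ω) :=
  (Sw_cont ω).measurableEmbedding (Sw_inj ω)

lemma Sw_mem (ω : List ℕ) (hω : ∀ i ∈ ω, 1 ≤ i) {x : ℝ} (hx : x ∈ Set.Icc (0 : ℝ) 1) :
    Sw ω x ∈ Set.Icc (0 : ℝ) 1 := by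
  induction ω with
  | nil => exact hx
  | cons j ω ih =>
    rw [Sw_cons]
    obtain ⟨i, rfl⟩ : ∃ i, j = i + 1 := ⟨j - 1, by have := hω j (by simp); omega⟩
    exact S_mem i (ih fun i hi => hω i (by simp [hi]))

section inv
variable {P : Measure ℝ} [IsProbabilityMeasure P]

lemma restrict_S (hs : ∀ᵐ x ∂P, x ∈ Set.Icc (0 : ℝ) 1) (hinv : Invariant P) (j : ℕ)
    {B : Set ℝ} (hB : MeasurableSet B) (hB1 : B ⊆ Set.Icc 0 1) :
    P.restrict (S (j + 1) '' B) = ENNReal.ofReal (p (j + 1)) • (P.restrict B).map (S (j + 1)) := by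
  have hSB : MeasurableSet (S (j + 1) '' B) := (S_emb _).measurableSet_image.2 hB
  ext A hA
  rw [Measure.restrict_apply hA, hinv _ (hA.inter hSB), tsum_eq_single j, Measure.smul_apply,
    Measure.map_apply (S_cont _).measurable hA,
    Measure.restrict_apply ((S_cont _).measurable hA), Set.preimage_inter,
    Set.preimage_image_eq _ (S_inj _), smul_eq_mul]
  intro i hij
  have : P (S (i + 1) ⁻¹' (A ∩ S (j + 1) '' B)) = 0 := by
    rw [← nonpos_iff_eq_zero, ← (ae_iff.1 hs)]
    refine measure_mono ?_
    rintro x ⟨-, y, hy, hxy⟩ hx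
    rcases lt_or_gt_of_ne hij with h | h
    · exact absurd hxy (S_lt h hx (hB1 hy)).ne'
    · exact absurd hxy (S_lt h (hB1 hy) hx).ne
  rw [this, mul_zero]

lemma restrict_Sw (hs : ∀ᵐ x ∂P, x ∈ Set.Icc (0 : ℝ) 1) (hinv : Invariant P) (ω : List ℕ)
    (hω : ∀ i ∈ ω, 1 ≤ i) {B : Set ℝ} (hB : MeasurableSet B) (hB1 : B ⊆ Set.Icc 0 1) :
    P.restrict (Sw ω '' B) = ENNReal.ofReal (pw ω) • (P.restrict B).map (Sw ω) := by
  induction ω with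
  | nil => simp [Sw, pw]
  | cons j ω ih =>
    obtain ⟨i, rfl⟩ : ∃ i, j = i + 1 := ⟨j - 1, by have := hω j (by simp); omega⟩
    have hω' : ∀ i ∈ ω, 1 ≤ i := fun i hi => hω i (by simp [hi])
    have h : pw ((i + 1) :: ω) = p (i + 1) * pw ω := by simp [pw]
    rw [Sw_cons, Set.image_comp, restrict_S hs hinv i ((Sw_emb ω).measurableSet_image.2 hB),
      ih hω', Measure.map_smul, Measure.map_map (S_cont _).measurable (Sw_cont _).measurable,
      smul_smul, h, ENNReal.ofReal_mul (p_pos _).le]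
    rintro _ ⟨x, hx, rfl⟩
    exact Sw_mem ω hω' (hB1 hx)

/-- The conditional measure on `⋃_{j≥2} J_j`. -/
def QQ (P : Measure ℝ) : Measure ℝ :=
  Measure.sum fun j : ℕ => ENNReal.ofReal (1 / 2 ^ (j + 1)) • P.map (S (j + 2))

lemma QQ_apply (P : Measure ℝ) {A : Set ℝ} (hA : MeasurableSet A) :
    QQ P A = ∑' j : ℕ, ENNReal.ofReal (1 / 2 ^ (j + 1)) * P (S (j + 2) ⁻¹' A) := by
  rw [QQ, Measure.sum_apply _ hA]
  congr 1
  ext j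
  rw [Measure.smul_apply, Measure.map_apply (S_cont _).measurable hA, smul_eq_mul]

instance : IsProbabilityMeasure (QQ P) := by
  constructor
  rw [QQ_apply P MeasurableSet.univ]
  simp only [Set.preimage_univ, measure_univ, mul_one]
  have h : HasSum (fun j : ℕ => (1 : ℝ) / 2 ^ (j + 1)) 1 := by
    have := hasSum_geometric_two' (1 : ℝ)
    refine this.congr_fun ?_
    intro j
    rw [pow_succ']; field_simp
  rw [← ENNReal.ofReal_tsum_of_nonneg (fun j => by positivity) h.summable, h.tsum_eq]
  simp

lemma sys_QQ (hs : ∀ᵐ x ∂P, x ∈ Set.Icc (0 : ℝ) 1) (hinv : Invariant P) : Sys P (QQ P) := by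
  refine ⟨hs, ?_, ?_, ?_⟩
  · rw [QQ, Measure.ae_sum_iff' (p := fun x => x ∈ Set.Icc (1 / 2 : ℝ) 1) measurableSet_Icc]
    intro j
    refine Measure.ae_smul_measure ?_ _
    rw [ae_map_iff (p := fun x => x ∈ Set.Icc (1 / 2 : ℝ) 1) (S_cont _).aemeasurable
      measurableSet_Icc]
    filter_upwards [hs] with x hx
    exact S_mem2 j hx
  · ext A hA
    rw [Measure.add_apply, Measure.smul_apply, Measure.smul_apply, QQ_apply P hA,
      Measure.map_apply (S_cont _).measurable hA, hinv A hA,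
      tsum_eq_zero_add' ENNReal.summable, smul_eq_mul, smul_eq_mul, ← ENNReal.tsum_mul_left]
    refine congrArg₂ (· + ·) ?_ ?_
    · simp [p]
    · congr 1
      ext j
      rw [← mul_assoc, ← ENNReal.ofReal_mul (by norm_num)]
      have := p_add 0 j
      rw [zero_add] at this
      rw [show j + 1 + 1 = j + 2 from rfl, this]
      norm_num
  · ext A hA
    rw [Measure.add_apply, Measure.smul_apply, Measure.smul_apply,
      Measure.map_apply (S_cont _).measurable hA, Measure.map_apply TT_cont.measurable hA,
      QQ_apply P hA, QQ_apply P (TT_cont.measurable hA),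
      tsum_eq_zero_add' ENNReal.summable, smul_eq_mul, smul_eq_mul, ← ENNReal.tsum_mul_left]
    congr 1
    · norm_num
    · congr 1
      ext j
      rw [← mul_assoc, ← ENNReal.ofReal_mul (by norm_num), ← Set.preimage_comp]
      congr 2
      · rw [pow_succ _ (j + 1)]; congr 1; field_simp
      · congr 1
        ext x
        rw [show j + 1 + 2 = 1 + j + 2 by ring, S_Tk]
        simp only [Tk, TT, Function.comp]
        ring

lemma Tk_cont (k : ℕ) : Continuous (Tk k) := by unfold Tk; fun_prop

lemma restrict_U (hs : ∀ᵐ x ∂P, x ∈ Set.Icc (0 : ℝ) 1) (hinv : Invariant P) (k : ℕ) :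
    P.restrict (⋃ j : ℕ, S (k + j + 2) '' Set.Icc 0 1) =
      ENNReal.ofReal (3 / 2 ^ (k + 2)) • (QQ P).map (Tk k) := by
  have hm : ∀ j : ℕ, MeasurableSet (S (k + j + 2) '' Set.Icc (0 : ℝ) 1) :=
    fun j => (S_emb _).measurableSet_image.2 measurableSet_Icc
  rw [Measure.restrict_iUnion ?_ hm]
  · ext A hA
    rw [Measure.sum_apply _ hA, Measure.smul_apply, Measure.map_apply (Tk_cont k).measurable hA,
      QQ_apply P ((Tk_cont k).measurable hA), smul_eq_mul, ← ENNReal.tsum_mul_left]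
    congr 1
    ext j
    rw [show k + j + 2 = (k + j + 1) + 1 from rfl,
      restrict_S hs hinv _ measurableSet_Icc subset_rfl,
      Measure.restrict_eq_self_of_ae_mem hs, Measure.smul_apply,
      Measure.map_apply (S_cont _).measurable hA, smul_eq_mul,
      show k + j + 1 + 1 = k + j + 2 from rfl, p_add, ENNReal.ofReal_mul (by positivity),
      mul_assoc, ← Set.preimage_comp]
    have : S (k + j + 2) = Tk k ∘ S (j + 2) := funext (S_Tk k j)
    rw [this]
  · intro i j hij
    refine Set.disjoint_left.2 ?_
    rintro _ ⟨x, hx, rfl⟩ ⟨y, hy, hxy⟩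
    rcases lt_or_gt_of_ne hij with h | h
    · exact absurd hxy (S_lt (show k + i + 1 < k + j + 1 by omega) hx hy).ne'
    · exact absurd hxy (S_lt (show k + j + 1 < k + i + 1 by omega) hy hx).ne

lemma cond_eq {B : Set ℝ} {c : ℝ} (hc : 0 < c) {μ : Measure ℝ} [IsProbabilityMeasure μ]
    (h : P.restrict B = ENNReal.ofReal c • μ) : ProbabilityTheory.cond P B = μ := by
  have hB : P B = ENNReal.ofReal c := by
    rw [← Measure.restrict_apply_univ, h]
    simp
  rw [ProbabilityTheory.cond, h, hB, smul_smul, ENNReal.inv_mul_cancel (by simpa using hc) (by simp),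
    one_smul]

end inv

/-- For every nonempty word `ω`: `{a(ω1), a(ω1,∞)}` is the unique optimal set of two-means
for `P(·|J_ω)`, and `{a(ω^-(ω_k+1)), a(ω^-(ω_k+1),∞)}` is the unique optimal set of two-means
for `P(·|J_{(ω,∞)})`. -/
theorem stmt_6 (P : Measure ℝ) [IsProbabilityMeasure P]
    (hsupp : P (Set.Icc 0 1) = 1) (hinv : Invariant P) (ω : List ℕ) (hω : IsWord ω) :
    (IsOptimal (ProbabilityTheory.cond P (Jw ω)) 2
        ({aw (ω ++ [1]), ainf (ω ++ [1])} : Set ℝ) ∧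
      ∀ α : Set ℝ, IsOptimal (ProbabilityTheory.cond P (Jw ω)) 2 α →
        α = ({aw (ω ++ [1]), ainf (ω ++ [1])} : Set ℝ)) ∧
    (IsOptimal (ProbabilityTheory.cond P (Jinf ω)) 2
        ({aw (wext ω 1), ainf (wext ω 1)} : Set ℝ) ∧
      ∀ α : Set ℝ, IsOptimal (ProbabilityTheory.cond P (Jinf ω)) 2 α →
        α = ({aw (wext ω 1), ainf (wext ω 1)} : Set ℝ)) := by
  have hs : ∀ᵐ x ∂P, x ∈ Set.Icc (0 : ℝ) 1 :=
    (mem_ae_iff_prob_eq_one measurableSet_Icc).2 hsupp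
  have sys := sys_QQ hs hinv
  have hmap : ∀ (μ : Measure ℝ) (τ : List ℕ),
      μ.map (Sw τ) = μ.map (fun x => sw τ * x + Sw τ 0) := by
    intro μ τ
    rw [← funext (Sw_affine τ)]
  constructor
  · haveI : IsProbabilityMeasure (P.map (Sw ω)) :=
      Measure.isProbabilityMeasure_map (Sw_cont ω).aemeasurable
    have hc : ProbabilityTheory.cond P (Jw ω) = P.map (Sw ω) := by
      refine cond_eq (pw_pos ω) ?_
      rw [Jw, restrict_Sw hs hinv ω hω.2 measurableSet_Icc subset_rfl,
        Measure.restrict_eq_self_of_ae_mem hs]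
    have h := (sys.uoptP.map (sw ω) (Sw ω 0) (sw_pos ω)).isOptimal
    have e1 : aw (ω ++ [1]) = sw ω * (1 / 7) + Sw ω 0 := by
      rw [aw, Sw_append, Sw_single, Function.comp_apply, Sw_affine, S1_eq]
      norm_num
    have e2 : ainf (ω ++ [1]) = sw ω * (5 / 7) + Sw ω 0 := by
      have : wext (ω ++ [1]) 1 = ω ++ [2] := by simp [wext, wlast]
      rw [ainf, this, Sw_append, Sw_single, Function.comp_apply, Sw_affine, S2_eq, sw_append]
      simp [sw, s]
      ring
    rw [hc, hmap, e1, e2]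
    exact h
  · obtain ⟨τ, k, rfl⟩ : ∃ τ k, ω = τ ++ [k + 1] := by
      refine ⟨ω.dropLast, ω.getLast hω.1 - 1, ?_⟩
      have := hω.2 _ (List.getLast_mem hω.1)
      rw [Nat.sub_add_cancel this, List.dropLast_append_getLast]
    have hτ : ∀ i ∈ τ, 1 ≤ i := fun i hi => hω.2 i (by simp [hi])
    have hw : ∀ j, wext (τ ++ [k + 1]) j = τ ++ [k + 1 + j] := by
      intro j; simp [wext, wlast]
    haveI : IsProbabilityMeasure ((QQ P).map (Tk k)) :=
      Measure.isProbabilityMeasure_map (Tk_cont k).aemeasurable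
    haveI : IsProbabilityMeasure (((QQ P).map (Tk k)).map (Sw τ)) :=
      Measure.isProbabilityMeasure_map (Sw_cont τ).aemeasurable
    have hJ : Jinf (τ ++ [k + 1]) = Sw τ '' (⋃ j : ℕ, S (k + j + 2) '' Set.Icc 0 1) := by
      rw [Jinf, Set.image_iUnion]
      refine Set.iUnion_congr fun j => ?_
      rw [hw, Jw, Sw_append, Sw_single, Set.image_comp,
        show k + 1 + (j + 1) = k + j + 2 by ring]
    have hU : MeasurableSet (⋃ j : ℕ, S (k + j + 2) '' Set.Icc (0 : ℝ) 1) :=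
      MeasurableSet.iUnion fun j => (S_emb _).measurableSet_image.2 measurableSet_Icc
    have hU1 : (⋃ j : ℕ, S (k + j + 2) '' Set.Icc (0 : ℝ) 1) ⊆ Set.Icc 0 1 := by
      refine Set.iUnion_subset fun j => ?_
      rintro _ ⟨x, hx, rfl⟩
      exact S_mem (k + j + 1) hx
    have hc : ProbabilityTheory.cond P (Jinf (τ ++ [k + 1])) =
        ((QQ P).map (Tk k)).map (Sw τ) := by
      refine cond_eq (c := pw τ * (3 / 2 ^ (k + 2))) (mul_pos (pw_pos τ) (by positivity)) ?_
      rw [hJ, restrict_Sw hs hinv τ hτ hU hU1, restrict_U hs hinv k, Measure.map_smul, smul_smul,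
        ENNReal.ofReal_mul (pw_pos τ).le]
    have h0 := sys.uoptQ.map (1 / 2 ^ k) (1 - 1 / 2 ^ k) (by positivity)
    have h := (h0.map (sw τ) (Sw τ 0) (sw_pos τ)).isOptimal
    have e1 : aw (τ ++ [k + 1 + 1]) =
        sw τ * ((1 / 2 ^ k) * (4 / 7) + (1 - 1 / 2 ^ k)) + Sw τ 0 := by
      rw [aw, Sw_append, Sw_single, Function.comp_apply, Sw_affine, S_succ]
      simp only [pow_add]
      field_simp
      ring
    have e2 : ainf (τ ++ [k + 1 + 1]) =
        sw τ * ((1 / 2 ^ k) * (6 / 7) + (1 - 1 / 2 ^ k)) + Sw τ 0 := by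
      have : wext (τ ++ [k + 1 + 1]) 1 = τ ++ [k + 1 + 1 + 1] := by simp [wext, wlast]
      have h3 : sw [k + 1 + 1 + 1] = 1 / 2 ^ (k + 4) := by simp [sw, s]
      rw [ainf, this, Sw_append, Sw_single, Function.comp_apply, Sw_affine, S_succ, sw_append, h3]
      simp only [pow_add]
      field_simp
      ring
    rw [hc, hmap, hw, e1, e2]
    exact h
end
end

section
/- The set {1/7, 4/7, 6/7} is the unique optimal set of three-means for P, and the third quantization error is V_3 = 57/14308. -/
open MeasureTheory

noncomputable section

/-- The tail functional, over the letters `j ≥ 2`. -/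
def Qf (P : Measure ℝ) (f : ℝ → ℝ) : ℝ := ∑' j : ℕ, p (j + 2) * ∫ x, f (S (j + 2) x) ∂P

lemma p_nonneg (j : ℕ) : 0 ≤ p j := by
  unfold p; split_ifs <;> positivity

lemma ae_mem {P : Measure ℝ} [IsProbabilityMeasure P] (hsupp : P (Set.Icc 0 1) = 1) :
    ∀ᵐ x ∂P, x ∈ Set.Icc (0:ℝ) 1 :=
  (prob_compl_eq_zero_iff measurableSet_Icc).2 hsupp

lemma cont_int {P : Measure ℝ} [IsProbabilityMeasure P] (hsupp : P (Set.Icc 0 1) = 1)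
    {f : ℝ → ℝ} (hf : Continuous f) : Integrable f P := by
  have h : IntegrableOn f (Set.Icc (0:ℝ) 1) P := hf.integrableOn_Icc
  rwa [IntegrableOn, Measure.restrict_eq_self_of_ae_mem (ae_mem hsupp)] at h

lemma P_hasSum {P : Measure ℝ} [IsProbabilityMeasure P] (hsupp : P (Set.Icc 0 1) = 1)
    (hinv : Invariant P) {f : ℝ → ℝ} (hf : Continuous f) :
    HasSum (fun j : ℕ => p (j + 1) * ∫ x, f (S (j + 1) x) ∂P) (∫ x, f x ∂P) := by
  have hP : P = Measure.sum (fun j : ℕ => ENNReal.ofReal (p (j + 1)) • P.map (S (j + 1))) := by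
    ext A hA
    rw [hinv A hA, Measure.sum_apply _ hA]
    refine tsum_congr fun j => ?_
    rw [Measure.smul_apply, Measure.map_apply (S_cont _).measurable hA, smul_eq_mul]
  have hi := cont_int hsupp hf
  have h := hasSum_integral_measure (hP ▸ hi)
  rw [← hP] at h
  have e : (fun j : ℕ => p (j + 1) * ∫ x, f (S (j + 1) x) ∂P) = fun i =>
      ∫ x, f x ∂(ENNReal.ofReal (p (i + 1)) • Measure.map (S (i + 1)) P) := by
    funext j
    rw [integral_smul_measure, integral_map (S_cont _).aemeasurable hf.aestronglyMeasurable,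
      ENNReal.toReal_ofReal (p_nonneg _), smul_eq_mul]
  rw [e]
  exact h

lemma Q_summable {P : Measure ℝ} [IsProbabilityMeasure P] (hsupp : P (Set.Icc 0 1) = 1)
    (hinv : Invariant P) {f : ℝ → ℝ} (hf : Continuous f) :
    Summable (fun j : ℕ => p (j + 2) * ∫ x, f (S (j + 2) x) ∂P) :=
  (summable_nat_add_iff 1).2 (P_hasSum hsupp hinv hf).summable

lemma P_eq {P : Measure ℝ} [IsProbabilityMeasure P] (hsupp : P (Set.Icc 0 1) = 1)
    (hinv : Invariant P) {f : ℝ → ℝ} (hf : Continuous f) :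
    ∫ x, f x ∂P = 1 / 4 * (∫ x, f (1 / 4 * x) ∂P) + Qf P f := by
  have h := P_hasSum hsupp hinv hf
  rw [← h.tsum_eq, h.summable.tsum_eq_zero_add, Qf]
  congr 1
  have : ∀ x, S (0 + 1) x = 1 / 4 * x := by intro x; unfold S; norm_num; ring
  simp only [this]
  norm_num [p]

lemma Q_eq {P : Measure ℝ} [IsProbabilityMeasure P] (hsupp : P (Set.Icc 0 1) = 1)
    (hinv : Invariant P) {f : ℝ → ℝ} (hf : Continuous f) :
    Qf P f = 3 / 8 * (∫ x, f (1 / 8 * x + 1 / 2) ∂P)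
      + 1 / 2 * Qf P (fun x => f (1 / 2 * x + 1 / 2)) := by
  have h := Q_summable hsupp hinv hf
  rw [Qf, h.tsum_eq_zero_add, Qf, ← tsum_mul_left]
  congr 1
  · have : ∀ x, S (0 + 2) x = 1 / 8 * x + 1 / 2 := by intro x; unfold S; norm_num; ring
    simp only [this]
    norm_num [p]
  · refine tsum_congr fun j => ?_
    have : ∀ x, S (j + 1 + 2) x = 1 / 2 * S (j + 2) x + 1 / 2 := by
      intro x; unfold S
      have e : j + 1 + 2 - 1 = (j + 1) + 1 := by omega
      have e2 : j + 2 - 1 = j + 1 := by omega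
      rw [e, e2]
      field_simp
      ring
    simp only [this]
    rw [← mul_assoc]
    congr 1
    unfold p
    rw [if_neg (by omega), if_neg (by omega)]
    field_simp
    ring

lemma P_mono {P : Measure ℝ} [IsProbabilityMeasure P] (hsupp : P (Set.Icc 0 1) = 1)
    {f g : ℝ → ℝ} (hf : Continuous f) (hg : Continuous g)
    (h : ∀ x, 0 ≤ x → x ≤ 1 → f x ≤ g x) : ∫ x, f x ∂P ≤ ∫ x, g x ∂P := by
  refine integral_mono_ae (cont_int hsupp hf) (cont_int hsupp hg) ?_
  filter_upwards [ae_mem hsupp] with x hx using h x hx.1 hx.2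

lemma Q_mono {P : Measure ℝ} [IsProbabilityMeasure P] (hsupp : P (Set.Icc 0 1) = 1)
    (hinv : Invariant P) {f g : ℝ → ℝ} (hf : Continuous f) (hg : Continuous g)
    (h : ∀ x, 1 / 2 ≤ x → x ≤ 1 → f x ≤ g x) : Qf P f ≤ Qf P g := by
  refine (Q_summable hsupp hinv hf).tsum_le_tsum (fun j => ?_) (Q_summable hsupp hinv hg)
  refine mul_le_mul_of_nonneg_left ?_ (p_nonneg _)
  refine P_mono hsupp (hf.comp (S_cont _)) (hg.comp (S_cont _)) fun x h0 h1 => ?_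
  have e2 : j + 2 - 1 = j + 1 := by omega
  have hj : (0:ℝ) < 1 / 2 ^ j := by positivity
  have hj1 : (1:ℝ) / 2 ^ j ≤ 1 := by
    rw [div_le_one (by positivity)]; exact one_le_pow₀ (by norm_num)
  have hS : S (j + 2) x = (x / 8 - 1 / 2) * (1 / 2 ^ j) + 1 := by
    unfold S; rw [e2]; field_simp; ring
  apply h <;> rw [hS] <;> nlinarith

/-- Moments of quadratics. -/
lemma P_quad {P : Measure ℝ} [IsProbabilityMeasure P] (hsupp : P (Set.Icc 0 1) = 1)
    (u v w : ℝ) : ∫ x, (u * x ^ 2 + v * x + w) ∂P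
      = u * (∫ x, x ^ 2 ∂P) + v * (∫ x, x ∂P) + w := by
  have h2 : Integrable (fun x : ℝ => u * x ^ 2) P := cont_int hsupp (by fun_prop)
  have h1 : Integrable (fun x : ℝ => v * x) P := cont_int hsupp (by fun_prop)
  rw [integral_add (f := fun x : ℝ => u * x ^ 2 + v * x) (h2.add h1) (integrable_const _),
    integral_add h2 h1, integral_const_mul, integral_const_mul]
  simp

lemma Q_quad {P : Measure ℝ} [IsProbabilityMeasure P] (hsupp : P (Set.Icc 0 1) = 1)
    (hinv : Invariant P)
    (u v w : ℝ) : Qf P (fun x => u * x ^ 2 + v * x + w)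
      = u * (63 / 64) * (∫ x, x ^ 2 ∂P) + v * (15 / 16) * (∫ x, x ∂P) + 3 / 4 * w := by
  have h := P_eq hsupp hinv (f := fun x => u * x ^ 2 + v * x + w) (by fun_prop)
  have e : ∀ x : ℝ, u * (1 / 4 * x) ^ 2 + v * (1 / 4 * x) + w
    = (u / 16) * x ^ 2 + (v / 4) * x + w := by intro x; ring
  simp only [e] at h
  rw [P_quad hsupp, P_quad hsupp] at h
  linarith

lemma moments {P : Measure ℝ} [IsProbabilityMeasure P] (hsupp : P (Set.Icc 0 1) = 1)
    (hinv : Invariant P) : ∫ x, x ∂P = 4 / 7 ∧ ∫ x, x ^ 2 ∂P = 208 / 511 := by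
  have h1 := Q_eq hsupp hinv (f := fun x => 0 * x ^ 2 + 1 * x + 0) (by fun_prop)
  have h2 := Q_eq hsupp hinv (f := fun x => 1 * x ^ 2 + 0 * x + 0) (by fun_prop)
  have e1 : ∀ x : ℝ, 0 * (1 / 8 * x + 1 / 2) ^ 2 + 1 * (1 / 8 * x + 1 / 2) + 0
    = 0 * x ^ 2 + (1 / 8) * x + 1 / 2 := by intro x; ring
  have e2 : ∀ x : ℝ, 0 * (1 / 2 * x + 1 / 2) ^ 2 + 1 * (1 / 2 * x + 1 / 2) + 0
    = 0 * x ^ 2 + (1 / 2) * x + 1 / 2 := by intro x; ring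
  have e3 : ∀ x : ℝ, 1 * (1 / 8 * x + 1 / 2) ^ 2 + 0 * (1 / 8 * x + 1 / 2) + 0
    = (1 / 64) * x ^ 2 + (1 / 8) * x + 1 / 4 := by intro x; ring
  have e4 : ∀ x : ℝ, 1 * (1 / 2 * x + 1 / 2) ^ 2 + 0 * (1 / 2 * x + 1 / 2) + 0
    = (1 / 4) * x ^ 2 + (1 / 2) * x + 1 / 4 := by intro x; ring
  simp only [e1, e2] at h1
  simp only [e3, e4] at h2
  rw [Q_quad hsupp hinv, P_quad hsupp, Q_quad hsupp hinv] at h1 h2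
  constructor <;> linarith

/-- Exact value and lower bound of a quadratic over a `P`-piece. -/
lemma P_val {P : Measure ℝ} [IsProbabilityMeasure P] (hsupp : P (Set.Icc 0 1) = 1)
    (hinv : Invariant P) (k d t : ℝ) :
    ∫ x, (k * x + d - t) ^ 2 ∂P
      = k ^ 2 * (208 / 511) + 2 * k * (d - t) * (4 / 7) + (d - t) ^ 2 := by
  have e : ∀ x : ℝ, (k * x + d - t) ^ 2 = k ^ 2 * x ^ 2 + (2 * k * (d - t)) * x + (d - t) ^ 2 := by
    intro x; ring
  simp only [e]
  rw [P_quad hsupp, (moments hsupp hinv).1, (moments hsupp hinv).2]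

lemma Q_val {P : Measure ℝ} [IsProbabilityMeasure P] (hsupp : P (Set.Icc 0 1) = 1)
    (hinv : Invariant P) (k d t : ℝ) :
    Qf P (fun x => (k * x + d - t) ^ 2)
      = k ^ 2 * (117 / 292) + 2 * k * (d - t) * (15 / 28) + 3 / 4 * (d - t) ^ 2 := by
  have e : ∀ x : ℝ, (k * x + d - t) ^ 2 = k ^ 2 * x ^ 2 + (2 * k * (d - t)) * x + (d - t) ^ 2 := by
    intro x; ring
  simp only [e]
  rw [Q_quad hsupp hinv, (moments hsupp hinv).1, (moments hsupp hinv).2]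
  ring

/-- Distance to the closest of three points, squared. -/
def ph (a b c x : ℝ) : ℝ := min ((x - a) ^ 2) (min ((x - b) ^ 2) ((x - c) ^ 2))

lemma ph_cont (a b c : ℝ) : Continuous (ph a b c) := by unfold ph; fun_prop

lemma ph_nonneg (a b c x : ℝ) : 0 ≤ ph a b c x := by unfold ph; positivity

/-- `t` is at least as close to `x` as `a`. -/
def Cl (x t a : ℝ) : Prop := (a ≤ t ∧ a + t ≤ 2 * x) ∨ (t ≤ a ∧ 2 * x ≤ a + t)

lemma Cl.sq {x t a : ℝ} (h : Cl x t a) : (x - t) ^ 2 ≤ (x - a) ^ 2 := by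
  rcases h with ⟨h1, h2⟩ | ⟨h1, h2⟩ <;> nlinarith

lemma ph_ge {a b c x t : ℝ} (ha : Cl x t a) (hb : Cl x t b) (hc : Cl x t c) :
    (x - t) ^ 2 ≤ ph a b c x := le_min ha.sq (le_min hb.sq hc.sq)

/-- Lower bound over a `P`-piece. -/
lemma P_ge {P : Measure ℝ} [IsProbabilityMeasure P] (hsupp : P (Set.Icc 0 1) = 1)
    (hinv : Invariant P) {a b c : ℝ} (k d t : ℝ)
    (h : ∀ x, 0 ≤ x → x ≤ 1 → Cl (k * x + d) t a ∧ Cl (k * x + d) t b ∧ Cl (k * x + d) t c) :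
    k ^ 2 * (208 / 511) + 2 * k * (d - t) * (4 / 7) + (d - t) ^ 2
      ≤ ∫ x, ph a b c (k * x + d) ∂P := by
  rw [← P_val hsupp hinv]
  refine P_mono hsupp (by fun_prop) ((ph_cont a b c).comp (by fun_prop)) fun x h0 h1 => ?_
  obtain ⟨ha, hb, hc⟩ := h x h0 h1
  exact ph_ge ha hb hc

lemma Q_ge {P : Measure ℝ} [IsProbabilityMeasure P] (hsupp : P (Set.Icc 0 1) = 1)
    (hinv : Invariant P) {a b c : ℝ} (k d t : ℝ)
    (h : ∀ x, 1 / 2 ≤ x → x ≤ 1 → Cl (k * x + d) t a ∧ Cl (k * x + d) t b ∧ Cl (k * x + d) t c) :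
    k ^ 2 * (117 / 292) + 2 * k * (d - t) * (15 / 28) + 3 / 4 * (d - t) ^ 2
      ≤ Qf P (fun x => ph a b c (k * x + d)) := by
  rw [← Q_val hsupp hinv]
  refine Q_mono hsupp hinv (by fun_prop) ((ph_cont a b c).comp (by fun_prop)) fun x h0 h1 => ?_
  obtain ⟨ha, hb, hc⟩ := h x h0 h1
  exact ph_ge ha hb hc

lemma P_nn {P : Measure ℝ} [IsProbabilityMeasure P] (a b c k d : ℝ) :
    0 ≤ ∫ x, ph a b c (k * x + d) ∂P := integral_nonneg fun x => ph_nonneg _ _ _ _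

lemma Q_nn {P : Measure ℝ} [IsProbabilityMeasure P] (a b c k d : ℝ) :
    0 ≤ Qf P (fun x => ph a b c (k * x + d)) :=
  tsum_nonneg fun j => mul_nonneg (p_nonneg _) (integral_nonneg fun x => ph_nonneg _ _ _ _)

/-- Splitting a `P`-piece. -/
lemma P_split {P : Measure ℝ} [IsProbabilityMeasure P] (hsupp : P (Set.Icc 0 1) = 1)
    (hinv : Invariant P) (a b c k d : ℝ) :
    ∫ x, ph a b c (k * x + d) ∂P = 1 / 4 * (∫ x, ph a b c (k / 4 * x + d) ∂P)
      + Qf P (fun x => ph a b c (k * x + d)) := by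
  rw [P_eq hsupp hinv (f := fun x => ph a b c (k * x + d)) ((ph_cont a b c).comp (by fun_prop))]
  have : ∀ x, k * (1 / 4 * x) + d = k / 4 * x + d := by intro x; ring
  simp only [this]

lemma Q_split {P : Measure ℝ} [IsProbabilityMeasure P] (hsupp : P (Set.Icc 0 1) = 1)
    (hinv : Invariant P) (a b c k d : ℝ) :
    Qf P (fun x => ph a b c (k * x + d)) =
      3 / 8 * (∫ x, ph a b c (k / 8 * x + (k / 2 + d)) ∂P)
      + 1 / 2 * Qf P (fun x => ph a b c (k / 2 * x + (k / 2 + d))) := by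
  rw [Q_eq hsupp hinv (f := fun x => ph a b c (k * x + d)) ((ph_cont a b c).comp (by fun_prop))]
  have : ∀ x, k * (1 / 8 * x + 1 / 2) + d = k / 8 * x + (k / 2 + d) := by intro x; ring
  have h2 : ∀ x, k * (1 / 2 * x + 1 / 2) + d = k / 2 * x + (k / 2 + d) := by intro x; ring
  simp only [this, h2]

lemma Cl_left {x t a : ℝ} (h : a ≤ t) (h2 : a + t ≤ 2 * x) : Cl x t a := Or.inl ⟨h, h2⟩
lemma Cl_right {x t a : ℝ} (h : t ≤ a) (h2 : 2 * x ≤ a + t) : Cl x t a := Or.inr ⟨h, h2⟩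
lemma Cl_refl {x t : ℝ} : Cl x t t := by
  rcases le_total t x with h | h
  · exact Or.inl ⟨le_rfl, by linarith⟩
  · exact Or.inr ⟨le_rfl, by linarith⟩

/-- Any set with one to three elements is a sorted triple, possibly with repetitions. -/
lemma sorted_triple {α : Set ℝ} (h1 : 1 ≤ α.ncard) (h3 : α.ncard ≤ 3) :
    ∃ a b c : ℝ, a ≤ b ∧ b ≤ c ∧ α = {a, b, c} := by
  have key : ∀ x y z : ℝ, ∃ a b c : ℝ, a ≤ b ∧ b ≤ c ∧ ({x, y, z} : Set ℝ) = {a, b, c} := by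
    intro x y z
    rcases le_total x y with h | h <;> rcases le_total y z with h' | h' <;>
      rcases le_total x z with h'' | h''
    · exact ⟨x, y, z, h, h', rfl⟩
    · exact ⟨x, y, z, h, h', rfl⟩
    · exact ⟨x, z, y, h'', h', by ext; simp; tauto⟩
    · exact ⟨z, x, y, h'', h, by ext; simp; tauto⟩
    · exact ⟨y, x, z, h, h'', by ext; simp; tauto⟩
    · exact ⟨y, z, x, h', h'', by ext; simp; tauto⟩
    · exact ⟨z, y, x, h', h, by ext; simp; tauto⟩
    · exact ⟨z, y, x, h', h, by ext; simp; tauto⟩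
  have : α.ncard = 1 ∨ α.ncard = 2 ∨ α.ncard = 3 := by omega
  rcases this with h | h | h
  · obtain ⟨x, rfl⟩ := Set.ncard_eq_one.1 h
    obtain ⟨a, b, c, hab, hbc, e⟩ := key x x x
    exact ⟨a, b, c, hab, hbc, by rw [← e]; simp⟩
  · obtain ⟨x, y, -, rfl⟩ := Set.ncard_eq_two.1 h
    obtain ⟨a, b, c, hab, hbc, e⟩ := key x y y
    exact ⟨a, b, c, hab, hbc, by rw [← e]; simp⟩
  · obtain ⟨x, y, z, -, -, -, rfl⟩ := Set.ncard_eq_three.1 h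
    exact key x y z

lemma dist_eq (P : Measure ℝ) (a b c : ℝ) :
    distortion P ({a, b, c} : Set ℝ) = ∫ x, ph a b c x ∂P := by
  unfold distortion
  congr 1
  ext x
  have : Nonempty ({a, b, c} : Set ℝ) := ⟨⟨a, by simp⟩⟩
  have bdd : BddBelow (Set.range fun i : ({a, b, c} : Set ℝ) => (x - (i : ℝ)) ^ 2) :=
    ⟨0, by rintro _ ⟨i, rfl⟩; positivity⟩
  apply le_antisymm
  · refine le_min ?_ (le_min ?_ ?_)
    · exact ciInf_le bdd ⟨a, by simp⟩
    · exact ciInf_le bdd ⟨b, by simp⟩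
    · exact ciInf_le bdd ⟨c, by simp⟩
  · refine le_ciInf ?_
    rintro ⟨i, hi⟩
    simp only [Set.mem_insert_iff, Set.mem_singleton_iff] at hi
    unfold ph
    rcases hi with rfl | rfl | rfl <;> simp


/-- Contribution of a `P`-piece. -/
def IP (P : Measure ℝ) (a b c k d : ℝ) : ℝ := ∫ x, ph a b c (k * x + d) ∂P

/-- Contribution of a tail piece. -/
def IQ (P : Measure ℝ) (a b c k d : ℝ) : ℝ := Qf P (fun x => ph a b c (k * x + d))

section
variable {P : Measure ℝ} [IsProbabilityMeasure P]

lemma IP_nn (a b c k d : ℝ) : 0 ≤ IP P a b c k d := P_nn _ _ _ _ _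

lemma IQ_nn (a b c k d : ℝ) : 0 ≤ IQ P a b c k d := Q_nn _ _ _ _ _

lemma IP_split (hsupp : P (Set.Icc 0 1) = 1) (hinv : Invariant P) (a b c k d k' : ℝ)
    (hk : k' = k / 4) : IP P a b c k d = 1 / 4 * IP P a b c k' d + IQ P a b c k d := by
  subst hk; exact P_split hsupp hinv a b c k d

lemma IQ_split (hsupp : P (Set.Icc 0 1) = 1) (hinv : Invariant P) (a b c k d k' k'' d' : ℝ)
    (hk : k' = k / 8) (hk'' : k'' = k / 2) (hd : d' = k / 2 + d) :
    IQ P a b c k d = 3 / 8 * IP P a b c k' d' + 1 / 2 * IQ P a b c k'' d' := by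
  subst hk hk'' hd; exact Q_split hsupp hinv a b c k d

lemma IP_top (hsupp : P (Set.Icc 0 1) = 1) (hinv : Invariant P) (a b c : ℝ) :
    ∫ x, ph a b c x ∂P = 1 / 4 * IP P a b c (1 / 4) 0 + 3 / 8 * IP P a b c (1 / 8) (1 / 2)
      + 1 / 2 * IQ P a b c (1 / 2) (1 / 2) := by
  have h0 : ∫ x, ph a b c x ∂P = IP P a b c 1 0 := by simp [IP]
  rw [h0, IP_split hsupp hinv a b c 1 0 (1 / 4) (by norm_num),
    IQ_split hsupp hinv a b c 1 0 (1 / 8) (1 / 2) (1 / 2) (by norm_num) (by norm_num)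
      (by norm_num)]
  ring

/-- The case in which the Voronoi boundaries lie in the gaps. -/
lemma gap_case (hsupp : P (Set.Icc 0 1) = 1) (hinv : Invariant P) {a b c : ℝ}
    (hab : a ≤ b) (hbc : b ≤ c) (h1 : 1 / 2 ≤ a + b) (h2 : a + b ≤ 1)
    (h3 : 5 / 4 ≤ b + c) (h4 : b + c ≤ 3 / 2) :
    57 / 14308 + 1 / 4 * (a - 1 / 7) ^ 2 + 3 / 8 * (b - 4 / 7) ^ 2 + 3 / 8 * (c - 6 / 7) ^ 2
      ≤ ∫ x, ph a b c x ∂P := by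
  have e1 : _ ≤ IP P a b c (1 / 4) 0 := P_ge hsupp hinv (1 / 4) 0 a fun x _ _ =>
    ⟨Cl_refl, Cl_right (by linarith) (by linarith), Cl_right (by linarith) (by linarith)⟩
  have e2 : _ ≤ IP P a b c (1 / 8) (1 / 2) := P_ge hsupp hinv (1 / 8) (1 / 2) b fun x _ _ =>
    ⟨Cl_left (by linarith) (by linarith), Cl_refl, Cl_right (by linarith) (by linarith)⟩
  have e3 : _ ≤ IQ P a b c (1 / 2) (1 / 2) := Q_ge hsupp hinv (1 / 2) (1 / 2) c fun x _ _ =>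
    ⟨Cl_left (by linarith) (by linarith), Cl_left (by linarith) (by linarith), Cl_refl⟩
  rw [IP_top hsupp hinv]
  linarith

lemma opt_val (hsupp : P (Set.Icc 0 1) = 1) (hinv : Invariant P) :
    ∫ x, ph (1 / 7) (4 / 7) (6 / 7) x ∂P = 57 / 14308 := by
  apply le_antisymm
  · rw [IP_top hsupp hinv]
    have c0 := ph_cont (1 / 7) (4 / 7) (6 / 7)
    have e1 : IP P (1 / 7) (4 / 7) (6 / 7) (1 / 4) 0 ≤ ∫ x, (1 / 4 * x + 0 - 1 / 7) ^ 2 ∂P :=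
      P_mono hsupp (c0.comp (by fun_prop)) (by fun_prop) fun x _ _ => min_le_left _ _
    have e2 : IP P (1 / 7) (4 / 7) (6 / 7) (1 / 8) (1 / 2)
        ≤ ∫ x, (1 / 8 * x + 1 / 2 - 4 / 7) ^ 2 ∂P :=
      P_mono hsupp (c0.comp (by fun_prop)) (by fun_prop) fun x _ _ =>
        (min_le_right _ _).trans (min_le_left _ _)
    have e3 : IQ P (1 / 7) (4 / 7) (6 / 7) (1 / 2) (1 / 2)
        ≤ Qf P fun x => (1 / 2 * x + 1 / 2 - 6 / 7) ^ 2 :=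
      Q_mono hsupp hinv (c0.comp (by fun_prop)) (by fun_prop) fun x _ _ =>
        (min_le_right _ _).trans (min_le_right _ _)
    rw [P_val hsupp hinv] at e1 e2
    rw [Q_val hsupp hinv] at e3
    linarith
  · have := gap_case (P := P) hsupp hinv (a := 1 / 7) (b := 4 / 7) (c := 6 / 7)
      (by norm_num) (by norm_num) (by norm_num) (by norm_num) (by norm_num) (by norm_num)
    norm_num at this ⊢
    linarith

set_option maxHeartbeats 4000000 in
lemma main_ineq (hsupp : P (Set.Icc 0 1) = 1) (hinv : Invariant P) {a b c : ℝ}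
    (hab : a ≤ b) (hbc : b ≤ c) (hD : ∫ x, ph a b c x ∂P ≤ 57 / 14308) :
    a = 1 / 7 ∧ b = 4 / 7 ∧ c = 6 / 7 := by
  have hD0 := hD
  rw [IP_top hsupp hinv] at hD
  have n1 := IP_nn (P := P) a b c (1 / 4) 0
  have n2 := IP_nn (P := P) a b c (1 / 8) (1 / 2)
  have n3 := IQ_nn (P := P) a b c (1 / 2) (1 / 2)
  -- splitting J_1
  have s1 := IP_split (P := P) hsupp hinv a b c (1 / 4) 0 (1 / 16) (by norm_num)
  have n11 := IP_nn (P := P) a b c (1 / 16) 0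
  -- splitting J_2
  have s2 := IP_split (P := P) hsupp hinv a b c (1 / 8) (1 / 2) (1 / 32) (by norm_num)
  have s2' := IQ_split (P := P) hsupp hinv a b c (1 / 8) (1 / 2) (1 / 64) (1 / 16) (9 / 16)
    (by norm_num) (by norm_num) (by norm_num)
  have n23 := IQ_nn (P := P) a b c (1 / 16) (9 / 16)
  -- splitting the tail after J_2
  have s3 := IQ_split (P := P) hsupp hinv a b c (1 / 2) (1 / 2) (1 / 16) (1 / 4) (3 / 4)
    (by norm_num) (by norm_num) (by norm_num)
  have n4 := IQ_nn (P := P) a b c (1 / 4) (3 / 4)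
  have s3' := IP_split (P := P) hsupp hinv a b c (1 / 16) (3 / 4) (1 / 64) (by norm_num)
  -- c ≥ 3/4
  have hc : 3 / 4 ≤ c := by
    by_contra! hc
    have e3 : _ ≤ IQ P a b c (1 / 2) (1 / 2) := Q_ge hsupp hinv (1 / 2) (1 / 2) (3 / 4)
      fun x _ _ => ⟨Cl_left (by linarith) (by linarith), Cl_left (by linarith) (by linarith),
        Cl_left (by linarith) (by linarith)⟩
    linarith
  -- a ≤ 1/4
  have ha : a ≤ 1 / 4 := by
    by_contra! ha
    have e1 : _ ≤ IP P a b c (1 / 4) 0 := P_ge hsupp hinv (1 / 4) 0 (1 / 4)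
      fun x _ _ => ⟨Cl_right (by linarith) (by linarith), Cl_right (by linarith) (by linarith),
        Cl_right (by linarith) (by linarith)⟩
    linarith
  -- b ≥ 9/20
  have hb : 9 / 20 ≤ b := by
    by_contra! hb
    have e21 : _ ≤ IP P a b c (1 / 32) (1 / 2) := P_ge hsupp hinv (1 / 32) (1 / 2) (9 / 20)
      fun x _ _ => ⟨Cl_left (by linarith) (by linarith), Cl_left (by linarith) (by linarith),
        Cl_right (by linarith) (by linarith)⟩
    have e22 : _ ≤ IP P a b c (1 / 64) (9 / 16) := P_ge hsupp hinv (1 / 64) (9 / 16) (9 / 20)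
      fun x _ _ => ⟨Cl_left (by linarith) (by linarith), Cl_left (by linarith) (by linarith),
        Cl_right (by linarith) (by linarith)⟩
    rcases le_total c 1 with h | h
    · have e3 : _ ≤ IQ P a b c (1 / 2) (1 / 2) := Q_ge hsupp hinv (1 / 2) (1 / 2) c
        fun x _ _ => ⟨Cl_left (by linarith) (by linarith), Cl_left (by linarith) (by linarith),
          Cl_refl⟩
      linarith [sq_nonneg (c - 6 / 7)]
    · have e3 : _ ≤ IQ P a b c (1 / 2) (1 / 2) := Q_ge hsupp hinv (1 / 2) (1 / 2) 1
        fun x _ _ => ⟨Cl_left (by linarith) (by linarith), Cl_left (by linarith) (by linarith),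
          Cl_right (by linarith) (by linarith)⟩
      linarith
  -- b ≤ 17/25
  have hb' : b ≤ 17 / 25 := by
    by_contra! hb'
    have e2 : _ ≤ IP P a b c (1 / 8) (1 / 2) := P_ge hsupp hinv (1 / 8) (1 / 2) (17 / 25)
      fun x _ _ => ⟨Cl_left (by linarith) (by linarith), Cl_right (by linarith) (by linarith),
        Cl_right (by linarith) (by linarith)⟩
    linarith
  -- the contribution of J_1 when a < 1/20
  have f1 : a < 1 / 20 → 3 / 4 * (57 / 14308) < 1 / 4 * IP P a b c (1 / 4) 0 := by
    intro h
    have e1 : _ ≤ IQ P a b c (1 / 4) 0 := Q_ge hsupp hinv (1 / 4) 0 (1 / 20)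
      fun x _ _ => ⟨Cl_left (by linarith) (by linarith), Cl_right (by linarith) (by linarith),
        Cl_right (by linarith) (by linarith)⟩
    linarith
  have g1 : 9 / 7154 ≤ 1 / 4 * IP P a b c (1 / 4) 0 := by
    rcases lt_or_ge a (1 / 20) with h | h
    · linarith [f1 h]
    · have e1 : _ ≤ IP P a b c (1 / 4) 0 := P_ge hsupp hinv (1 / 4) 0 a
        fun x _ _ => ⟨Cl_refl, Cl_right (by linarith) (by linarith),
          Cl_right (by linarith) (by linarith)⟩
      linarith [sq_nonneg (a - 1 / 7)]
  -- the contribution of J_2 when it is not cut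
  have g2 : 5 / 4 ≤ b + c →
      27 / 57232 + 3 / 8 * (b - 4 / 7) ^ 2 ≤ 3 / 8 * IP P a b c (1 / 8) (1 / 2) := by
    intro h
    have e2 : _ ≤ IP P a b c (1 / 8) (1 / 2) := P_ge hsupp hinv (1 / 8) (1 / 2) b
      fun x _ _ => ⟨Cl_left (by linarith) (by linarith), Cl_refl,
        Cl_right (by linarith) (by linarith)⟩
    linarith
  -- the contribution of the tail when it is not cut
  have g3 : b + c ≤ 3 / 2 →
      129 / 57232 + 3 / 8 * (c - 6 / 7) ^ 2 ≤ 1 / 2 * IQ P a b c (1 / 2) (1 / 2) := by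
    intro h
    have e3 : _ ≤ IQ P a b c (1 / 2) (1 / 2) := Q_ge hsupp hinv (1 / 2) (1 / 2) c
      fun x _ _ => ⟨Cl_left (by linarith) (by linarith), Cl_left (by linarith) (by linarith),
        Cl_refl⟩
    linarith
  -- b ≤ 13/20
  have hb2 : b ≤ 13 / 20 := by
    by_contra! h
    have := g2 (by linarith)
    have hbb : (11 / 140 : ℝ) ^ 2 ≤ (b - 4 / 7) ^ 2 := by
      apply pow_le_pow_left₀ (by norm_num); linarith
    linarith
  -- a ≥ 1/20
  have ha2 : 1 / 20 ≤ a := by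
    by_contra! h
    have h1 := f1 h
    rcases le_or_gt (b + c) (3 / 2) with h2 | h2
    · linarith [g3 h2, sq_nonneg (c - 6 / 7)]
    · have e1 : _ ≤ IQ P a b c (1 / 4) 0 := Q_ge hsupp hinv (1 / 4) 0 (1 / 20)
        fun x _ _ => ⟨Cl_left (by linarith) (by linarith), Cl_right (by linarith) (by linarith),
          Cl_right (by linarith) (by linarith)⟩
      have e3 : _ ≤ IP P a b c (1 / 16) (3 / 4) := P_ge hsupp hinv (1 / 16) (3 / 4) (17 / 20)
        fun x _ _ => ⟨Cl_left (by linarith) (by linarith), Cl_left (by linarith) (by linarith),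
          Cl_right (by linarith) (by linarith)⟩
      linarith
  -- the second boundary is at least 5/8
  have hv : 5 / 4 ≤ b + c := by
    by_contra! h
    have := g3 (by linarith)
    have hcc : (2 / 35 : ℝ) ^ 2 ≤ (6 / 7 - c) ^ 2 := by
      apply pow_le_pow_left₀ (by norm_num); linarith
    linarith
  -- the second boundary is at most 3/4
  have hv2 : b + c ≤ 3 / 2 := by
    by_contra! h
    have h2 := g2 hv
    rcases lt_or_ge b (3 / 5) with hb3 | hb3
    · have e3 : _ ≤ IP P a b c (1 / 16) (3 / 4) := P_ge hsupp hinv (1 / 16) (3 / 4) (9 / 10)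
        fun x _ _ => ⟨Cl_left (by linarith) (by linarith), Cl_left (by linarith) (by linarith),
          Cl_right (by linarith) (by linarith)⟩
      linarith [sq_nonneg (b - 4 / 7)]
    · have hbb : (1 / 35 : ℝ) ^ 2 ≤ (b - 4 / 7) ^ 2 := by
        apply pow_le_pow_left₀ (by norm_num); linarith
      rcases le_or_gt (9 / 10) c with hc3 | hc3
      · have e31 : _ ≤ IP P a b c (1 / 64) (3 / 4) := P_ge hsupp hinv (1 / 64) (3 / 4) (13 / 20)
          fun x _ _ => ⟨Cl_left (by linarith) (by linarith), Cl_left (by linarith) (by linarith),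
            Cl_right (by linarith) (by linarith)⟩
        have e3q : _ ≤ IQ P a b c (1 / 16) (3 / 4) := Q_ge hsupp hinv (1 / 16) (3 / 4) (9 / 10)
          fun x _ _ => ⟨Cl_left (by linarith) (by linarith), Cl_left (by linarith) (by linarith),
            Cl_right (by linarith) (by linarith)⟩
        linarith
      · have e31 : _ ≤ IP P a b c (1 / 64) (3 / 4) := P_ge hsupp hinv (1 / 64) (3 / 4) (17 / 20)
          fun x _ _ => ⟨Cl_left (by linarith) (by linarith), Cl_left (by linarith) (by linarith),
            Cl_right (by linarith) (by linarith)⟩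
        have e3q : _ ≤ IQ P a b c (1 / 16) (3 / 4) := Q_ge hsupp hinv (1 / 16) (3 / 4) c
          fun x _ _ => ⟨Cl_left (by linarith) (by linarith), Cl_left (by linarith) (by linarith),
            Cl_refl⟩
        have e4 : _ ≤ IQ P a b c (1 / 4) (3 / 4) := Q_ge hsupp hinv (1 / 4) (3 / 4) c
          fun x _ _ => ⟨Cl_left (by linarith) (by linarith), Cl_left (by linarith) (by linarith),
            Cl_refl⟩
        linarith [sq_nonneg (c - 87 / 100)]
  have hfin := gap_case (P := P) hsupp hinv hab hbc (by linarith) (by linarith) hv hv2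
  have qa := sq_nonneg (a - 1 / 7)
  have qb := sq_nonneg (b - 4 / 7)
  have qc := sq_nonneg (c - 6 / 7)
  refine ⟨?_, ?_, ?_⟩
  · exact sub_eq_zero.1 (pow_eq_zero_iff (two_ne_zero) |>.1 (by linarith))
  · exact sub_eq_zero.1 (pow_eq_zero_iff (two_ne_zero) |>.1 (by linarith))
  · exact sub_eq_zero.1 (pow_eq_zero_iff (two_ne_zero) |>.1 (by linarith))

end

/-- `{1/7, 4/7, 6/7}` is the unique optimal set of three-means for `P`, and `V₃ = 57/14308`. -/
theorem stmt_7 (P : Measure ℝ) [IsProbabilityMeasure P]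
    (hsupp : P (Set.Icc 0 1) = 1) (hinv : Invariant P) :
    IsOptimal P 3 ({1 / 7, 4 / 7, 6 / 7} : Set ℝ) ∧
    (∀ α : Set ℝ, IsOptimal P 3 α → α = ({1 / 7, 4 / 7, 6 / 7} : Set ℝ)) ∧
    quantErr P 3 = 57 / 14308 := by
  have hopt : distortion P ({1 / 7, 4 / 7, 6 / 7} : Set ℝ) = 57 / 14308 := by
    rw [dist_eq, opt_val hsupp hinv]
  have hcard : ({1 / 7, 4 / 7, 6 / 7} : Set ℝ).ncard = 3 :=
    Set.ncard_eq_three.2 ⟨1 / 7, 4 / 7, 6 / 7, by norm_num, by norm_num, by norm_num, rfl⟩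
  have huniq : ∀ α : Set ℝ, 1 ≤ α.ncard → α.ncard ≤ 3 → distortion P α ≤ 57 / 14308 →
      α = ({1 / 7, 4 / 7, 6 / 7} : Set ℝ) := by
    intro α h1 h3 hd
    obtain ⟨a, b, c, hab, hbc, rfl⟩ := sorted_triple h1 h3
    rw [dist_eq] at hd
    obtain ⟨rfl, rfl, rfl⟩ := main_ineq hsupp hinv hab hbc hd
    rfl
  have hq : quantErr P 3 = 57 / 14308 := by
    refine IsLeast.csInf_eq ⟨⟨_, by omega, by omega, hopt.symm⟩, ?_⟩
    rintro r ⟨α, h1, h3, rfl⟩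
    by_contra! hlt
    rw [huniq α h1 h3 hlt.le, hopt] at hlt
    exact lt_irrefl _ hlt
  refine ⟨⟨by omega, by omega, by rw [hopt, hq]⟩, ?_, hq⟩
  rintro α ⟨h1, h3, hd⟩
  exact huniq α h1 h3 (by rw [hd, hq])
end
end
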